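/- arXiv:2212.14292 — 2 statements merged into one kernel-verified Lean document; each statement's English description precedes it below -/
import Mathlib

section
/- Let X be a Cantor set and G a group acting faithfully on X by homeomorphisms which is a topological full group. Suppose there exists a basis 𝓘 for the topology of X consisting of nonempty proper clopen subsets of X which is closed under complements (I ∈ 𝓘 implies X∖I ∈ 𝓘), is preserved by G (g·I ∈ 𝓘 for all g ∈ G, I ∈ 𝓘), and such that G acts transitively on 𝓘⁽³⁾ and on 𝓘⁽⁴⁾. Suppose moreover that the abelianization G/[G,G] is finite. Then G is hereditary (NL): every finite-index subgroup of G has Property (NL). -/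
/-- An action of `G` on `X` by homeomorphisms. -/
def IsActionByHomeos (G : Type*) [Group G] (X : Type*) [TopologicalSpace X]
    (a : G → X → X) : Prop :=
  (∀ x, a 1 x = x) ∧ (∀ g h x, a (g * h) x = a g (a h x)) ∧
    (∀ g : G, Continuous (a g))

/-- The action is faithful. -/
def FaithfulAction (G : Type*) [Group G] (X : Type*) (a : G → X → X) : Prop :=
  ∀ g : G, (∀ x, a g x = x) → g = 1

/-- `X` is a Cantor set: nonempty, compact, metrizable, totally disconnected,
without isolated points. -/
def IsCantorSet (X : Type*) [TopologicalSpace X] : Prop :=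
  Nonempty X ∧ CompactSpace X ∧ TopologicalSpace.MetrizableSpace X ∧
    TotallyDisconnectedSpace X ∧ ∀ x : X, ¬ IsOpen ({x} : Set X)

/-- `G` (acting via `a`) is a topological full group: it contains every
homeomorphism which locally agrees with elements of `G`. -/
def IsTopologicalFullGroup (G : Type*) [Group G] (X : Type*)
    [TopologicalSpace X] (a : G → X → X) : Prop :=
  ∀ f : X ≃ₜ X,
    (∀ x : X, ∃ U : Set X, IsOpen U ∧ x ∈ U ∧ ∃ g : G, ∀ y ∈ U, f y = a g y) →
    ∃ g : G, ∀ x : X, a g x = f x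

/-- `(I, J, K) ∈ 𝓘⁽³⁾`: a triple of members of `𝓘` with pairwise disjoint
closures whose union is not dense. -/
def Tup3 {X : Type*} [TopologicalSpace X] (𝓘 : Set (Set X))
    (I J K : Set X) : Prop :=
  I ∈ 𝓘 ∧ J ∈ 𝓘 ∧ K ∈ 𝓘 ∧ Disjoint (closure I) (closure J) ∧
    Disjoint (closure I) (closure K) ∧ Disjoint (closure J) (closure K) ∧
    ¬ Dense (I ∪ J ∪ K)

/-- `(I, J, K, L) ∈ 𝓘⁽⁴⁾`: a quadruple of members of `𝓘` with pairwise
disjoint closures whose union is not dense. -/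
def Tup4 {X : Type*} [TopologicalSpace X] (𝓘 : Set (Set X))
    (I J K L : Set X) : Prop :=
  I ∈ 𝓘 ∧ J ∈ 𝓘 ∧ K ∈ 𝓘 ∧ L ∈ 𝓘 ∧
    Disjoint (closure I) (closure J) ∧ Disjoint (closure I) (closure K) ∧
    Disjoint (closure I) (closure L) ∧ Disjoint (closure J) (closure K) ∧
    Disjoint (closure J) (closure L) ∧ Disjoint (closure K) (closure L) ∧
    ¬ Dense (I ∪ J ∪ K ∪ L)

def IsGeodesicSpace (X : Type*) [MetricSpace X] : Prop :=
  ∀ x y : X, ∃ γ : ℝ → X, γ 0 = x ∧ γ (dist x y) = y ∧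
    ∀ s ∈ Set.Icc (0 : ℝ) (dist x y), ∀ t ∈ Set.Icc (0 : ℝ) (dist x y),
      dist (γ s) (γ t) = |s - t|

def IsGromovHyperbolic (X : Type*) [MetricSpace X] : Prop :=
  ∃ δ : ℝ, 0 ≤ δ ∧ ∀ x y z w : X,
    dist x y + dist z w ≤ max (dist x z + dist y w) (dist x w + dist y z) + 2 * δ

def IsIsometricAction (G : Type*) [Group G] (X : Type*) [MetricSpace X]
    (a : G → X → X) : Prop :=
  (∀ x, a 1 x = x) ∧ (∀ g h x, a (g * h) x = a g (a h x)) ∧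
    (∀ g x y, dist (a g x) (a g y) = dist x y)

def IsLoxodromic (G : Type*) [Group G] (X : Type*) [MetricSpace X]
    (a : G → X → X) (g : G) : Prop :=
  ∃ (x : X) (A B : ℝ), 1 ≤ A ∧ 0 ≤ B ∧ ∀ m n : ℤ,
    |(m : ℝ) - (n : ℝ)| / A - B ≤ dist (a (g ^ m) x) (a (g ^ n) x) ∧
      dist (a (g ^ m) x) (a (g ^ n) x) ≤ A * |(m : ℝ) - (n : ℝ)| + B

/-- Property (NL): no isometric action on a Gromov hyperbolic geodesic metric
space admits a loxodromic element. -/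
def PropertyNL (G : Type*) [Group G] : Prop :=
  ∀ (X : Type) [MetricSpace X], IsGeodesicSpace X → IsGromovHyperbolic X →
    ∀ a : G → X → X, IsIsometricAction G X a → ∀ g : G, ¬ IsLoxodromic G X a g


namespace NLAux

open Filter Topology

/-! ### Quasimorphisms -/

theorem exists_ulim {α : Type*} (𝒰 : Ultrafilter α) (f : α → ℝ) (C : ℝ)
    (hf : ∀ᶠ x in (𝒰 : Filter α), |f x| ≤ C) : ∃ l, Tendsto f 𝒰 (𝓝 l) := by
  have hc : IsCompact (Set.Icc (-C) C) := isCompact_Icc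
  obtain ⟨l, -, hl⟩ := hc.ultrafilter_le_nhds (𝒰.map f) (by
    rw [Ultrafilter.coe_map, le_principal_iff, mem_map]
    filter_upwards [hf] with x hx
    exact abs_le.1 hx)
  exact ⟨l, hl⟩

theorem qm_pow {Γ : Type*} [Group Γ] (φ : Γ → ℝ) (D : ℝ)
    (hφ : ∀ g h, |φ (g * h) - φ g - φ h| ≤ D) (g : Γ) (n : ℕ) :
    |φ (g ^ (n + 1)) - (n + 1) * φ g| ≤ (n + 1) * D := by
  have hD : 0 ≤ D := (abs_nonneg _).trans (hφ 1 1)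
  induction n with
  | zero => simpa using hD
  | succ n ih =>
    have h1 := hφ (g ^ (n + 1)) g
    rw [← pow_succ] at h1
    push_cast
    rw [abs_le] at *
    constructor <;> linarith [h1.1, h1.2, ih.1, ih.2]

theorem homogenize {Γ : Type*} [Group Γ] (φ : Γ → ℝ) (D : ℝ)
    (hφ : ∀ g h, |φ (g * h) - φ g - φ h| ≤ D) :
    ∃ Φ : Γ → ℝ, (∀ g, |Φ g - φ g| ≤ D) ∧ (∀ g h, Commute g h → Φ (g * h) = Φ g + Φ h) ∧
      (∀ g k, Φ (k * g * k⁻¹) = Φ g) := by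
  have hD : 0 ≤ D := (abs_nonneg _).trans (hφ 1 1)
  set 𝒰 : Ultrafilter ℕ := hyperfilter ℕ
  have hle : (𝒰 : Filter ℕ) ≤ atTop := by
    rw [← Nat.cofinite_eq_atTop]; exact hyperfilter_le_cofinite
  have key : ∀ g, ∀ᶠ n : ℕ in (𝒰 : Filter ℕ), |φ (g ^ n) / n - φ g| ≤ D := by
    intro g
    apply hle
    filter_upwards [eventually_ge_atTop 1] with n hn
    obtain ⟨m, rfl⟩ : ∃ m, n = m + 1 := ⟨n - 1, by omega⟩
    have h := qm_pow φ D hφ g m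
    have hm : (0 : ℝ) < m + 1 := by positivity
    have e : φ (g ^ (m + 1)) / ((m + 1 : ℕ) : ℝ) - φ g
        = (φ (g ^ (m + 1)) - (m + 1) * φ g) / (m + 1) := by
      push_cast; field_simp
    rw [e, abs_div, abs_of_pos hm, div_le_iff₀ hm]
    linarith
  have ex : ∀ g, ∃ l, Tendsto (fun n : ℕ => φ (g ^ n) / n) 𝒰 (𝓝 l) := by
    intro g
    apply exists_ulim 𝒰 _ (|φ g| + D)
    filter_upwards [key g] with n hn
    have := abs_add_le (φ (g ^ n) / n - φ g) (φ g)
    simp only [sub_add_cancel] at this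
    linarith
  choose Φ hΦ using ex
  have small : ∀ C : ℝ, ∀ f : ℕ → ℝ, (∀ n, |f n| ≤ C) →
      Tendsto (fun n : ℕ => f n / n) 𝒰 (𝓝 0) := by
    intro C f hf
    have h0 : Tendsto (fun n : ℕ => C / (n : ℝ)) 𝒰 (𝓝 0) :=
      (tendsto_const_div_atTop_nhds_zero_nat C).mono_left hle
    refine squeeze_zero_norm (fun n => ?_) h0
    rw [Real.norm_eq_abs, abs_div, Nat.abs_cast]
    gcongr
    exact hf n
  refine ⟨Φ, ?_, ?_, ?_⟩
  · intro g
    refine le_of_tendsto ((hΦ g).sub_const (φ g)).abs (key g)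
  · intro g h hgh
    have h1 := small D (fun n => φ ((g * h) ^ n) - φ (g ^ n) - φ (h ^ n)) (by
      intro n; rw [hgh.mul_pow]; exact hφ _ _)
    have h2 := ((hΦ (g * h)).sub (hΦ g)).sub (hΦ h)
    have h3 := tendsto_nhds_unique h1 (h2.congr (fun n => by ring))
    linarith
  · intro g k
    have h1 := small (2 * D + |φ k| + |φ k⁻¹|)
      (fun n => φ ((k * g * k⁻¹) ^ n) - φ (g ^ n)) (by
      intro n; rw [conj_pow]
      have e1 := hφ (k * g ^ n) k⁻¹
      have e2 := hφ k (g ^ n)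
      rw [abs_le] at *
      constructor <;>
        linarith [e1.1, e1.2, e2.1, e2.2, le_abs_self (φ k), le_abs_self (φ k⁻¹),
          neg_abs_le (φ k), neg_abs_le (φ k⁻¹)])
    have h2 := (hΦ (k * g * k⁻¹)).sub (hΦ g)
    have h3 := tendsto_nhds_unique h1 (h2.congr (fun n => by ring))
    linarith

/-- A homogeneous quasimorphism. -/
structure HQ {Γ : Type*} [Group Γ] (Φ : Γ → ℝ) (D : ℝ) : Prop where
  comm : ∀ g h, Commute g h → Φ (g * h) = Φ g + Φ h
  conj : ∀ g k, Φ (k * g * k⁻¹) = Φ g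
  defect : ∀ g h, |Φ (g * h) - Φ g - Φ h| ≤ D

theorem exists_HQ {Γ : Type*} [Group Γ] (φ : Γ → ℝ) (D : ℝ)
    (hφ : ∀ g h, |φ (g * h) - φ g - φ h| ≤ D) :
    ∃ Φ : Γ → ℝ, HQ Φ (4 * D) ∧ ∀ g, |Φ g - φ g| ≤ D := by
  obtain ⟨Φ, h1, h2, h3⟩ := homogenize φ D hφ
  refine ⟨Φ, ⟨h2, h3, fun g h => ?_⟩, h1⟩
  have a1 := h1 g
  have a2 := h1 h
  have a3 := h1 (g * h)
  have a4 := hφ g h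
  rw [abs_le] at *
  constructor <;> linarith [a1.1, a2.1, a3.1, a4.1, a1.2, a2.2, a3.2, a4.2]

namespace HQ
variable {Γ : Type*} [Group Γ] {Φ : Γ → ℝ} {D : ℝ}

theorem one (h : HQ Φ D) : Φ 1 = 0 := by
  have := h.comm 1 1 (Commute.refl _)
  simp only [mul_one] at this
  linarith

theorem inv (h : HQ Φ D) (g : Γ) : Φ g⁻¹ = - Φ g := by
  have := h.comm g g⁻¹ (Commute.inv_right (Commute.refl g))
  rw [mul_inv_cancel, h.one] at this
  linarith

theorem pow (h : HQ Φ D) (g : Γ) (n : ℕ) : Φ (g ^ n) = n * Φ g := by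
  induction n with
  | zero => simp [h.one]
  | succ n ih =>
    rw [pow_succ, h.comm _ _ (Commute.pow_left (Commute.refl g) n), ih]; push_cast; ring

theorem zpow (h : HQ Φ D) (g : Γ) (n : ℤ) : Φ (g ^ n) = n * Φ g := by
  obtain ⟨k, rfl | rfl⟩ := n.eq_nat_or_neg
  · simp [h.pow]
  · simp [h.pow, h.inv]

theorem invol (h : HQ Φ D) (g : Γ) (hg : g * g = 1) : Φ g = 0 := by
  have := h.pow g 2
  rw [pow_two, hg, h.one] at this
  push_cast at this; linarith

end HQ

theorem eq_of_mul_bdd {x D : ℝ} (h : ∀ n : ℕ, n * |x| ≤ D) : x = 0 := by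
  by_contra hx
  have hx' : 0 < |x| := abs_pos.2 hx
  obtain ⟨n, hn⟩ := exists_nat_gt (D / |x|)
  rw [div_lt_iff₀ hx'] at hn
  linarith [h n]

/-! ### Hyperbolic geometry -/

/-- Gromov product. -/
noncomputable def gp {M : Type*} [MetricSpace M] (o x y : M) : ℝ :=
  (dist o x + dist o y - dist x y) / 2

/-- Four point condition. -/
def Hyp (M : Type*) [MetricSpace M] (δ : ℝ) : Prop :=
  0 ≤ δ ∧ ∀ x y z w : M,
    dist x y + dist z w ≤ max (dist x z + dist y w) (dist x w + dist y z) + 2 * δ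

/-- Two sequences converge to the same boundary point. -/
def Asym {M : Type*} [MetricSpace M] (o : M) (p q : ℕ → M) : Prop :=
  ∀ R : ℝ, ∃ K : ℕ, ∀ n ≥ K, ∀ m ≥ K, R ≤ gp o (p n) (q m)

section
variable {M : Type*} [MetricSpace M] {δ : ℝ}

theorem gp_comm (o x y : M) : gp o x y = gp o y x := by
  simp only [gp, dist_comm x y]; ring

theorem Hyp.gp_min (h : Hyp M δ) (o x y z : M) :
    gp o x y - δ ≤ gp o x z ∨ gp o y z - δ ≤ gp o x z := by
  have := h.2 x z o y
  simp only [gp]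
  rcases le_max_iff.1 (sub_le_iff_le_add.2 this) with h' | h'
  · right; rw [dist_comm x o, dist_comm z y] at h'; linarith
  · left; rw [dist_comm z o] at h'; linarith

theorem Asym.symm {o : M} {p q : ℕ → M} (h : Asym o p q) : Asym o q p := by
  intro R
  obtain ⟨K, hK⟩ := h R
  exact ⟨K, fun n hn m hm => by rw [gp_comm]; exact hK m hm n hn⟩

theorem Asym.trans (hM : Hyp M δ) {o : M} {p q r : ℕ → M} (h : Asym o p q)
    (h' : Asym o q r) : Asym o p r := by
  intro R
  obtain ⟨K, hK⟩ := h (R + δ)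
  obtain ⟨K', hK'⟩ := h' (R + δ)
  refine ⟨max K K', fun n hn m hm => ?_⟩
  have h1 := hK n (le_of_max_le_left hn) (max K K') (le_max_left _ _)
  have h2 := hK' (max K K') (le_max_right _ _) m (le_of_max_le_right hm)
  rcases hM.gp_min o (p n) (q (max K K')) (r m) with h3 | h3 <;> linarith

theorem Asym.near {o : M} {p q q' : ℕ → M} (h : Asym o p q) (C : ℝ)
    (hC : ∀ n, dist (q n) (q' n) ≤ C) : Asym o p q' := by
  intro R
  obtain ⟨K, hK⟩ := h (R + C)
  refine ⟨K, fun n hn m hm => ?_⟩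
  have h1 := hK n hn m hm
  have h2 := hC m
  have h3 := dist_triangle o (q' m) (q m)
  have h4 := dist_triangle (p n) (q m) (q' m)
  rw [dist_comm (q' m)] at h3
  simp only [gp] at *
  linarith

variable {Γ : Type*} [Group Γ] [MulAction Γ M]

/-- Isometric action. -/
def Iso (Γ M : Type*) [Group Γ] [MetricSpace M] [MulAction Γ M] : Prop :=
  ∀ (g : Γ) (x y : M), dist (g • x) (g • y) = dist x y

theorem Iso.shift (hi : Iso Γ M) (g : Γ) (x y : M) :
    dist (g • x) y = dist x (g⁻¹ • y) := by
  have := hi g x (g⁻¹ • y)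
  rwa [smul_inv_smul] at this

theorem Asym.smul (hi : Iso Γ M) {o : M} {p q : ℕ → M} (h : Asym o p q) (g : Γ) :
    Asym o (fun n => g • p n) (fun n => g • q n) := by
  intro R
  obtain ⟨K, hK⟩ := h (R + dist o (g⁻¹ • o))
  refine ⟨K, fun n hn m hm => ?_⟩
  have h1 := hK n hn m hm
  have e1 : dist o (g • p n) = dist (g⁻¹ • o) (p n) := by
    rw [hi.shift, inv_inv]
  have e2 : dist o (g • q m) = dist (g⁻¹ • o) (q m) := by
    rw [hi.shift, inv_inv]
  have t1 := dist_triangle o (g⁻¹ • o) (p n)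
  have t2 := dist_triangle o (g⁻¹ • o) (q m)
  have e3 := hi g (p n) (q m)
  simp only [gp] at *
  linarith

/-- `g` fixes the boundary point of `p`. -/
def Fixes (o : M) (p : ℕ → M) (g : Γ) : Prop := Asym o (fun n => g • p n) p

theorem Fixes.mul (hM : Hyp M δ) (hi : Iso Γ M) {o : M} {p : ℕ → M} {g h : Γ}
    (hg : Fixes o p g) (hh : Fixes o p h) : Fixes o p (g * h) := by
  have := (Asym.smul hi hh g).trans hM hg
  simpa only [Fixes, mul_smul] using this

theorem Fixes.inv (hi : Iso Γ M) {o : M} {p : ℕ → M} {g : Γ}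
    (hg : Fixes o p g) : Fixes o p g⁻¹ := by
  have := (Asym.smul hi hg g⁻¹).symm
  simpa only [Fixes, inv_smul_smul] using this

theorem Fixes.self (hM : Hyp M δ) {o : M} {p : ℕ → M} {g : Γ}
    (hg : Fixes o p g) : Asym o p p := hg.symm.trans hM hg

theorem Fixes.one {o : M} {p : ℕ → M} (hp : Asym o p p) : Fixes o p (1 : Γ) := by
  simpa only [Fixes, one_smul] using hp

theorem Fixes.zpow (hM : Hyp M δ) (hi : Iso Γ M) {o : M} {p : ℕ → M} {g : Γ}
    (hg : Fixes o p g) (n : ℤ) : Fixes o p (g ^ n) := by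
  have hn : ∀ n : ℕ, Fixes o p (g ^ n) := by
    intro n
    induction n with
    | zero => simpa using Fixes.one (hg.self hM)
    | succ n ih => rw [pow_succ]; exact ih.mul hM hi hg
  obtain ⟨k, rfl | rfl⟩ := n.eq_nat_or_neg
  · simpa using hn k
  · simpa using (hn k).inv hi

/-- Transfer of being fixed along asymptotic sequences. -/
theorem Fixes.congr (hM : Hyp M δ) (hi : Iso Γ M) {o : M} {p q : ℕ → M} {g : Γ}
    (hg : Fixes o p g) (hpq : Asym o p q) : Fixes o q g :=
  ((Asym.smul hi hpq.symm g).trans hM hg).trans hM hpq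

/-- Linear growth. -/
def Lin (o : M) (g : Γ) : Prop :=
  ∃ c > 0, ∃ B : ℝ, ∀ n : ℕ, c * n - B ≤ dist o (g ^ n • o)

/-- A strong form of loxodromicity. -/
def SL (δ : ℝ) (o : M) (g : Γ) : Prop :=
  dist o (g • o) + 2 * δ + 1 ≤ dist o (g ^ 2 • o)

theorem not_lin_of_doubling {o : M} {g : Γ} (C : ℝ)
    (h : ∀ j : ℕ, dist o (g ^ (2 ^ (j + 1)) • o) ≤ dist o (g ^ (2 ^ j) • o) + C) :
    ¬ Lin o g := by
  rintro ⟨c, hc, B, hB⟩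
  have h1 : ∀ j : ℕ, dist o (g ^ (2 ^ j) • o) ≤ dist o (g • o) + j * C := by
    intro j
    induction j with
    | zero => simp
    | succ j ih => have := h j; push_cast; linarith
  have h2 : ∀ j : ℕ, c ≤ (B + dist o (g • o)) * (1 / 2 : ℝ) ^ j + C * (j * (1 / 2 : ℝ) ^ j) := by
    intro j
    have h3 := (hB (2 ^ j)).trans (h1 j)
    push_cast at h3
    have h4 : (0 : ℝ) < (1 / 2 : ℝ) ^ j := by positivity
    have h5 : (2 : ℝ) ^ j * (1 / 2 : ℝ) ^ j = 1 := by rw [← mul_pow]; norm_num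
    have h6 := mul_le_mul_of_nonneg_right h3 h4.le
    have : (c * 2 ^ j - B) * (1 / 2 : ℝ) ^ j = c - B * (1 / 2 : ℝ) ^ j := by
      rw [sub_mul, mul_assoc, h5, mul_one]
    rw [this] at h6
    nlinarith
  have t1 : Tendsto (fun j : ℕ => (1 / 2 : ℝ) ^ j) atTop (𝓝 0) :=
    tendsto_pow_atTop_nhds_zero_of_lt_one (by norm_num) (by norm_num)
  have t2 : Tendsto (fun j : ℕ => (j : ℝ) * (1 / 2 : ℝ) ^ j) atTop (𝓝 0) :=
    tendsto_self_mul_const_pow_of_lt_one (by norm_num) (by norm_num)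
  have t3 := (t1.const_mul (B + dist o (g • o))).add (t2.const_mul C)
  have := ge_of_tendsto' t3 h2
  simp at this
  linarith

theorem Lin.exists_SL {o : M} {g : Γ} (h : Lin o g) : ∃ k : ℕ, SL δ o (g ^ k) := by
  by_contra! hc
  refine not_lin_of_doubling (2 * δ + 1) (fun j => ?_) h
  have := hc (2 ^ j)
  rw [SL, not_le, ← pow_mul, ← pow_succ] at this
  linarith

theorem dist_smul_inv (hi : Iso Γ M) (o : M) (g : Γ) : dist o (g⁻¹ • o) = dist o (g • o) := by
  rw [← hi.shift, dist_comm]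

theorem SL.inv (hi : Iso Γ M) {o : M} {g : Γ} (h : SL δ o g) : SL δ o g⁻¹ := by
  rw [SL, inv_pow, dist_smul_inv hi, dist_smul_inv hi]; exact h

theorem SL.step (hM : Hyp M δ) (hi : Iso Γ M) {o : M} {g : Γ} (h : SL δ o g) (j : ℕ) :
    dist o (g ^ j • o) + 1 ≤ dist o (g ^ (j + 1) • o) := by
  induction j with
  | zero =>
    have : dist o (g ^ 2 • o) ≤ dist o (g • o) + dist o (g • o) := by
      have := dist_triangle o (g • o) (g ^ 2 • o)
      rw [pow_two, mul_smul, hi g o] at *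
      exact this
    rw [SL] at h
    have := hM.1
    simp; linarith
  | succ j ih =>
    -- four points `o, g^(j+1) o, g^j o, g^(j+2) o`
    have h4 := hM.2 o (g ^ (j + 1) • o) (g ^ j • o) (g ^ (j + 2) • o)
    have e1 : dist (g ^ j • o) (g ^ (j + 2) • o) = dist o (g ^ 2 • o) := by
      rw [pow_add, mul_smul, hi]
    have e2 : dist (g ^ (j + 1) • o) (g ^ (j + 2) • o) = dist o (g • o) := by
      rw [show j + 2 = (j + 1) + 1 from rfl, pow_succ g (j + 1), mul_smul, hi]
    have e3 : dist (g ^ (j + 1) • o) (g ^ j • o) = dist o (g • o) := by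
      rw [dist_comm, pow_succ g j, mul_smul, hi]
    rw [e1, e2, e3] at h4
    rw [SL] at h
    rcases le_max_iff.1 (sub_le_iff_le_add.2 h4) with h' | h'
    · linarith
    · show _ ≤ dist o (g ^ (j + 2) • o)
      linarith

theorem SL.step' (hM : Hyp M δ) (hi : Iso Γ M) {o : M} {g : Γ} (h : SL δ o g) (j k : ℕ) :
    dist o (g ^ j • o) + k ≤ dist o (g ^ (j + k) • o) := by
  induction k with
  | zero => simp
  | succ k ih => have := h.step hM hi (j + k); push_cast; rw [← add_assoc j k 1]; linarith

theorem SL.lin (hM : Hyp M δ) (hi : Iso Γ M) {o : M} {g : Γ} (h : SL δ o g) : Lin o g := by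
  refine ⟨1, one_pos, 0, fun n => ?_⟩
  have := h.step' hM hi 0 n
  simpa using this

theorem SL.asym (hM : Hyp M δ) (hi : Iso Γ M) {o : M} {g : Γ} (h : SL δ o g) :
    Asym o (fun n => g ^ n • o) (fun n => g ^ n • o) := by
  have key : ∀ m k : ℕ, (m : ℝ) / 2 ≤ gp o (g ^ m • o) (g ^ (m + k) • o) := by
    intro m k
    have e : dist (g ^ m • o) (g ^ (m + k) • o) = dist o (g ^ k • o) := by
      rw [pow_add, mul_smul, hi]
    have h1 := h.step' hM hi k m
    rw [gp, e, add_comm m k]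
    linarith [dist_nonneg (x := o) (y := g ^ m • o)]
  intro R
  obtain ⟨K, hK⟩ := exists_nat_gt (2 * R)
  refine ⟨K, fun n hn m hm => ?_⟩
  have hn' : (K : ℝ) ≤ n := by exact_mod_cast hn
  have hm' : (K : ℝ) ≤ m := by exact_mod_cast hm
  rcases le_total n m with h' | h' <;> obtain ⟨k, rfl⟩ := Nat.exists_eq_add_of_le h'
  · have := key n k; linarith
  · rw [gp_comm]; have := key m k; linarith

theorem SL.fixes (hM : Hyp M δ) (hi : Iso Γ M) {o : M} {g f : Γ} (h : SL δ o g)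
    (hf : Commute f g) : Fixes o (fun n => g ^ n • o) f := by
  refine ((h.asym hM hi).near (dist o (f • o)) fun n => ?_).symm
  rw [← mul_smul, (hf.pow_right n).eq, mul_smul, hi]

theorem Lin.pow {o : M} {g : Γ} (h : Lin o g) {k : ℕ} (hk : 0 < k) : Lin o (g ^ k) := by
  obtain ⟨c, hc, B, hB⟩ := h
  have hk' : (0 : ℝ) < k := by exact_mod_cast hk
  refine ⟨c * k, by positivity, B, fun n => ?_⟩
  have := hB (k * n)
  rw [pow_mul] at this
  push_cast at this
  linarith

theorem Lin.conj (hi : Iso Γ M) {o : M} {g : Γ} (h : Lin o g) (k : Γ) :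
    Lin o (k * g * k⁻¹) := by
  obtain ⟨c, hc, B, hB⟩ := h
  refine ⟨c, hc, B + 2 * dist o (k • o), fun n => ?_⟩
  have h1 := hB n
  rw [conj_pow]
  have e1 : dist o ((k * g ^ n * k⁻¹) • o) = dist (k⁻¹ • o) (g ^ n • k⁻¹ • o) := by
    rw [hi.shift k⁻¹, inv_inv, mul_smul, mul_smul]
  have e2 := dist_smul_inv hi o k
  have t1 := dist_triangle o (k⁻¹ • o) (g ^ n • o)
  have t2 := dist_triangle (k⁻¹ • o) (g ^ n • k⁻¹ • o) (g ^ n • o)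
  rw [hi, dist_comm (k⁻¹ • o) o] at t2
  linarith

/-! Busemann function -/

theorem exists_busemann (o : M) (p : ℕ → M) : ∃ β : Γ → ℝ, ∀ g : Γ,
    Tendsto (fun k => dist (g • o) (p k) - dist o (p k)) (hyperfilter ℕ : Ultrafilter ℕ)
      (𝓝 (β g)) := by
  have : ∀ g : Γ, ∃ l, Tendsto (fun k => dist (g • o) (p k) - dist o (p k))
      (hyperfilter ℕ : Ultrafilter ℕ) (𝓝 l) := fun g =>
    exists_ulim _ _ (dist (g • o) o) (Eventually.of_forall fun k =>
      abs_dist_sub_le _ _ _)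
  choose β hβ using this
  exact ⟨β, hβ⟩

theorem hyper_le : ((hyperfilter ℕ : Ultrafilter ℕ) : Filter ℕ) ≤ atTop := by
  rw [← Nat.cofinite_eq_atTop]; exact hyperfilter_le_cofinite

theorem busemann_defect (hM : Hyp M δ) (hi : Iso Γ M) {o : M} {p : ℕ → M} {β : Γ → ℝ}
    (hβ : ∀ g : Γ, Tendsto (fun k => dist (g • o) (p k) - dist o (p k))
      (hyperfilter ℕ : Ultrafilter ℕ) (𝓝 (β g))) {g : Γ} (hg : Fixes o p g) (h : Γ) :
    |β (g * h) - β g - β h| ≤ 2 * δ := by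
  have t := (((hβ (g * h)).sub (hβ g)).sub (hβ h)).abs
  refine le_of_tendsto t (hyper_le ?_)
  obtain ⟨K, hK⟩ := hg.inv hi (dist (h • o) o + δ + 1)
  filter_upwards [eventually_ge_atTop K] with k hk
  have h1 : _ ≤ gp o (g⁻¹ • p k) (p k) := hK k hk k hk
  have e1 : dist ((g * h) • o) (p k) = dist (h • o) (g⁻¹ • p k) := by rw [mul_smul, hi.shift]
  have e2 : dist (g • o) (p k) = dist o (g⁻¹ • p k) := hi.shift _ _ _
  rw [e1, e2]
  set y := h • o
  set q := g⁻¹ • p k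
  set r := p k
  simp only [gp] at h1
  have f1 := hM.2 y q o r
  have f2 := hM.2 y r o q
  have t1 := dist_triangle o y q
  have t2 := dist_triangle o y r
  rw [dist_comm o y] at t1 t2
  rw [dist_comm q o, dist_comm q r] at *
  rw [dist_comm r o] at *
  rw [abs_le]
  rcases le_max_iff.1 (sub_le_iff_le_add.2 f1) with h' | h' <;>
  rcases le_max_iff.1 (sub_le_iff_le_add.2 f2) with h'' | h'' <;>
  constructor <;> linarith [dist_comm r q, dist_comm o r, dist_comm q o]

theorem busemann_doubling (hM : Hyp M δ) (hi : Iso Γ M) {o : M} {p : ℕ → M} {β : Γ → ℝ}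
    (hβ : ∀ g : Γ, Tendsto (fun k => dist (g • o) (p k) - dist o (p k))
      (hyperfilter ℕ : Ultrafilter ℕ) (𝓝 (β g))) {C : ℝ} (g : Γ) (h1 : |β g| ≤ C)
      (h2 : |β (g * g)| ≤ C) :
    dist o ((g * g) • o) ≤ dist o (g • o) + (2 * C + 2 * δ) := by
  have key : ∀ k, dist o ((g * g) • o) - dist o (g • o) - 2 * δ ≤
      max ((dist ((g * g) • o) (p k) - dist o (p k)) - (dist (g • o) (p k) - dist o (p k)))
        (- (dist (g • o) (p k) - dist o (p k))) := by
    intro k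
    have h4 := hM.2 o ((g * g) • o) (g • o) (p k)
    have e1 : dist ((g * g) • o) (g • o) = dist o (g • o) := by
      rw [mul_smul, hi, dist_comm]
    rw [e1] at h4
    rw [le_max_iff]
    rcases le_max_iff.1 (sub_le_iff_le_add.2 h4) with h' | h'
    · left; linarith
    · right; linarith
  have t := ((hβ (g * g)).sub (hβ g)).max (hβ g).neg
  have := ge_of_tendsto' t key
  rw [abs_le] at h1 h2
  rcases le_max_iff.1 this with h' | h' <;> linarith [h1.1, h1.2, h2.1, h2.2]

theorem not_lin_of_fixes (hM : Hyp M δ) (hi : Iso Γ M) {o : M} {p : ℕ → M}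
    (hq : ∀ (φ : Γ → ℝ) (D : ℝ), (∀ g h, |φ (g * h) - φ g - φ h| ≤ D) → ∃ C, ∀ g, |φ g| ≤ C)
    (hp : ∀ g : Γ, Fixes o p g) (g : Γ) : ¬ Lin o g := by
  obtain ⟨β, hβ⟩ := exists_busemann (Γ := Γ) o p
  obtain ⟨C, hC⟩ := hq β (2 * δ) (fun g h => busemann_defect hM hi hβ (hp g) h)
  refine not_lin_of_doubling (2 * C + 2 * δ) fun j => ?_
  rw [pow_succ 2 j, mul_two, pow_add]
  exact busemann_doubling hM hi hβ _ (hC _) (hC _)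

theorem lin_fixes (hM : Hyp M δ) (hi : Iso Γ M) {o : M} {p : ℕ → M} {h : Γ}
    (hp : Fixes o p h) (hl : Lin o h) :
    Asym o (fun n => h ^ n • o) p ∨ Asym o (fun n => h⁻¹ ^ n • o) p := by
  obtain ⟨β, hβ⟩ := exists_busemann (Γ := Γ) o p
  obtain ⟨Φ, hΦ, hΦβ⟩ := exists_HQ (Γ := Multiplicative ℤ)
    (fun n => β (h ^ (Multiplicative.toAdd n))) (2 * δ) (fun m n => by
      rw [toAdd_mul, zpow_add]
      exact busemann_defect hM hi hβ (hp.zpow hM hi _) _)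
  set c := Φ (Multiplicative.ofAdd 1) with hcdef
  have hc : ∀ n : ℤ, |n * c - β (h ^ n)| ≤ 2 * δ := by
    intro n
    have h1 := hΦβ (Multiplicative.ofAdd n)
    have h2 := hΦ.zpow (Multiplicative.ofAdd 1) n
    rw [← ofAdd_zsmul, smul_eq_mul, mul_one] at h2
    rw [h2] at h1
    simpa using h1
  have aux : ∀ f : Γ, ∀ b : ℝ, 0 < b → (∀ n : ℕ, β (f ^ n) ≤ 2 * δ - b * n) →
      Asym o (fun n => f ^ n • o) p := by
    intro f b hb hf R
    obtain ⟨K, hK⟩ := hp.self hM (R + δ)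
    obtain ⟨K', hK'⟩ := exists_nat_gt ((2 * (R + δ) + 1 + 2 * δ) / b)
    rw [div_lt_iff₀ hb] at hK'
    refine ⟨max K K', fun n hn m hm => ?_⟩
    have hn' : (K' : ℝ) ≤ n := by exact_mod_cast le_of_max_le_right hn
    have ev := (hβ (f ^ n)).eventually (gt_mem_nhds (lt_add_one (β (f ^ n))))
    have ev2 := ev.and (hyper_le (eventually_ge_atTop K))
    obtain ⟨k, hk1, hk2⟩ := ev2.exists
    have g1 : R + δ ≤ gp o (f ^ n • o) (p k) := by
      have := hf n
      have h0 := dist_nonneg (x := o) (y := f ^ n • o)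
      simp only [gp]
      nlinarith
    have g2 := hK k hk2 m (le_of_max_le_left hm)
    rcases hM.gp_min o (f ^ n • o) (p k) (p m) with h3 | h3 <;> simp only at * <;> linarith
  rcases lt_trichotomy c 0 with h0 | h0 | h0
  · left
    refine aux h (-c) (by linarith) fun n => ?_
    have := hc n
    rw [zpow_natCast, abs_le] at this
    push_cast at this
    linarith [this.1]
  · exfalso
    have hb : ∀ n : ℕ, |β (h ^ n)| ≤ 2 * δ := by
      intro n
      have := hc n
      simpa [h0] using this
    refine not_lin_of_doubling (2 * (2 * δ) + 2 * δ) (fun j => ?_) hl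
    rw [pow_succ 2 j, mul_two, pow_add]
    refine busemann_doubling hM hi hβ _ (hb _) ?_
    rw [← pow_add]; exact hb _
  · right
    refine aux h⁻¹ c h0 fun n => ?_
    have := hc (-n)
    rw [zpow_neg, zpow_natCast, ← inv_pow, abs_le] at this
    push_cast at this
    linarith [this.1]

/-- No strongly loxodromic products: Gromov products are large. -/
theorem gp_of_not_SL (hM : Hyp M δ) (hi : Iso Γ M) {o : M} {a b : Γ}
    (ha : ¬ SL δ o a) (hb : ¬ SL δ o b) (hab : ¬ SL δ o (a * b)) :
    min (dist o (a • o)) (dist o (b • o)) / 2 - (20 * δ + 20) ≤ gp o (a • o) (b • o) := by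
  by_contra! hcon
  have hδ := hM.1
  have sq : ∀ c : Γ, dist (c⁻¹ • o) (c • o) = dist o (c ^ 2 • o) := by
    intro c; rw [hi.shift, inv_inv, pow_two, mul_smul]
  have key : ∀ c : Γ, ¬ SL δ o c →
      dist o (c • o) / 2 - δ - 1 / 2 ≤ gp o (c⁻¹ • o) (c • o) := by
    intro c hc
    rw [SL, not_le] at hc
    rw [gp, sq, dist_smul_inv hi]
    linarith
  have ka := key a ha
  have kb := key b hb
  rw [SL, not_le, ← sq (a * b)] at hab
  rw [← min_div_div_right (by norm_num : (0 : ℝ) ≤ 2)] at hcon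
  have m1 := min_le_left (dist o (a • o) / 2) (dist o (b • o) / 2)
  have m2 := min_le_right (dist o (a • o) / 2) (dist o (b • o) / 2)
  set t := gp o (a • o) (b • o) with ht
  set m := min (dist o (a • o) / 2) (dist o (b • o) / 2)
  -- `(a⁻¹ o | b o) ≤ t + δ`
  have s1 : gp o (a⁻¹ • o) (b • o) ≤ t + δ := by
    rcases hM.gp_min o (a • o) (a⁻¹ • o) (b • o) with h | h
    · rw [gp_comm o (a • o)] at h; linarith
    · linarith
  have s2 : gp o (a • o) (b⁻¹ • o) ≤ t + δ := by
    rcases hM.gp_min o (a • o) (b⁻¹ • o) (b • o) with h | h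
    · linarith
    · linarith
  have e1 : dist (a⁻¹ • o) (b • o) = dist o ((a * b) • o) := by
    rw [hi.shift, inv_inv, mul_smul]
  have e2 : dist ((a * b)⁻¹ • o) (b⁻¹ • o) = dist o (a • o) := by
    rw [mul_inv_rev, mul_smul, hi, hi.shift, inv_inv]
  have e3 : dist (a • o) ((a * b) • o) = dist o (b • o) := by
    rw [mul_smul, hi]
  have l1 : dist o ((a * b) • o) = dist o (a • o) + dist o (b • o) - 2 * gp o (a⁻¹ • o) (b • o) := by
    rw [gp, e1, dist_smul_inv hi]; ring
  have l2 : gp o ((a * b)⁻¹ • o) (b⁻¹ • o) = 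
      (dist o ((a * b) • o) + dist o (b • o) - dist o (a • o)) / 2 := by
    rw [gp, e2, dist_smul_inv hi, dist_smul_inv hi]
  have l3 : gp o (a • o) ((a * b) • o) =
      (dist o (a • o) + dist o ((a * b) • o) - dist o (b • o)) / 2 := by
    rw [gp, e3]
  have l4 : gp o ((a * b)⁻¹ • o) ((a * b) • o) =
      (2 * dist o ((a * b) • o) - dist ((a * b)⁻¹ • o) ((a * b) • o)) / 2 := by
    rw [gp, dist_smul_inv hi]; ring
  rw [gp_comm o (a • o) (b⁻¹ • o)] at s2
  rcases hM.gp_min o (b⁻¹ • o) ((a * b)⁻¹ • o) (a • o) with h | h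
  · rw [gp_comm o (b⁻¹ • o)] at h
    linarith
  · rcases hM.gp_min o ((a * b)⁻¹ • o) ((a * b) • o) (a • o) with h' | h'
    · linarith
    · rw [gp_comm o ((a * b) • o)] at h'
      linarith

theorem asym_of_not_SL (hM : Hyp M δ) (hi : Iso Γ M) {o : M} (S : Subgroup Γ)
    (hS : ∀ g ∈ S, ¬ SL δ o g) {u v : ℕ → Γ} (hu : ∀ n, u n ∈ S) (hv : ∀ n, v n ∈ S)
    (hu' : Tendsto (fun n => dist o (u n • o)) atTop atTop)
    (hv' : Tendsto (fun n => dist o (v n • o)) atTop atTop) :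
    Asym o (fun n => u n • o) (fun n => v n • o) := by
  intro R
  obtain ⟨K, hK⟩ := eventually_atTop.1 (hu'.eventually_ge_atTop (2 * (R + (20 * δ + 20))))
  obtain ⟨K', hK'⟩ := eventually_atTop.1 (hv'.eventually_ge_atTop (2 * (R + (20 * δ + 20))))
  refine ⟨max K K', fun n hn m hm => ?_⟩
  have h1 := hK n (le_of_max_le_left hn)
  have h2 := hK' m (le_of_max_le_right hm)
  have h3 := gp_of_not_SL hM hi (hS _ (hu n)) (hS _ (hv m)) (hS _ (S.mul_mem (hu n) (hv m)))
  have h4 := le_min h1 h2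
  simp only at *
  linarith

end

end NLAux
namespace NLAux
open Filter Topology

open scoped Pointwise

/-- The working hypotheses on the action on the Cantor set. -/
structure Crit (G : Type*) {X : Type*} [Group G] [TopologicalSpace X] [MulAction G X]
    (𝓘 : Set (Set X)) : Prop where
  cont : ∀ g : G, Continuous (fun x : X => g • x)
  t2 : T2Space X
  noiso : ∀ x : X, ¬ IsOpen ({x} : Set X)
  ne : Nonempty X
  faith : ∀ g : G, (∀ x : X, g • x = x) → g = 1
  full : ∀ f : X ≃ₜ X,
    (∀ x : X, ∃ U : Set X, IsOpen U ∧ x ∈ U ∧ ∃ g : G, ∀ y ∈ U, f y = g • y) →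
    ∃ g : G, ∀ x : X, g • x = f x
  basis : TopologicalSpace.IsTopologicalBasis 𝓘
  clopen : ∀ I ∈ 𝓘, I.Nonempty ∧ I ≠ Set.univ ∧ IsClopen I
  compl : ∀ I ∈ 𝓘, Iᶜ ∈ 𝓘
  pres : ∀ g : G, ∀ I ∈ 𝓘, g • I ∈ 𝓘
  trans3 : ∀ I J K I' J' K' : Set X, 
      I ∈ 𝓘 ∧ J ∈ 𝓘 ∧ K ∈ 𝓘 ∧ Disjoint I J ∧ Disjoint I K ∧ Disjoint J K ∧
        (∃ L ∈ 𝓘, Disjoint L (I ∪ J ∪ K)) →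
      I' ∈ 𝓘 ∧ J' ∈ 𝓘 ∧ K' ∈ 𝓘 ∧ Disjoint I' J' ∧ Disjoint I' K' ∧ Disjoint J' K' ∧
        (∃ L ∈ 𝓘, Disjoint L (I' ∪ J' ∪ K')) →
      ∃ g : G, g • I = I' ∧ g • J = J' ∧ g • K = K'

def Rist (G : Type*) {X : Type*} [Group G] [MulAction G X] (I : Set X) : Subgroup G where
  carrier := {g | ∀ x ∉ I, g • x = x}
  mul_mem' := by
    intro g h hg hh x hx
    rw [mul_smul, hh x hx, hg x hx]
  one_mem' := fun x _ => one_smul _ x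
  inv_mem' := by
    intro g hg x hx
    rw [inv_smul_eq_iff, hg x hx]

section
variable {G X : Type*} [Group G] [MulAction G X]

theorem mem_Rist {I : Set X} {g : G} : g ∈ Rist G I ↔ ∀ x ∉ I, g • x = x := Iff.rfl

theorem Rist_mono {I J : Set X} (h : I ⊆ J) : Rist G I ≤ Rist G J :=
  fun _ hg x hx => hg x (fun hI => hx (h hI))

theorem Rist_smul_mem {I : Set X} {g : G} (hg : g ∈ Rist G I) {x : X} (hx : x ∈ I) :
    g • x ∈ I := by
  by_contra h
  have h1 := hg _ h
  have h2 : g • x = x := by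
    have := congrArg (fun y => g⁻¹ • y) h1
    simpa using this
  rw [h2] at h; exact h hx

theorem Rist_conj {I : Set X} {g : G} (hg : g ∈ Rist G I) (k : G) :
    k * g * k⁻¹ ∈ Rist G (k • I) := by
  intro x hx
  rw [Set.mem_smul_set_iff_inv_smul_mem] at hx
  rw [mul_smul, mul_smul, hg _ hx, smul_inv_smul]

theorem Rist_conj_eq {I J : Set X} {g k : G} (hg : g ∈ Rist G I) (h : k • I = J) :
    k * g * k⁻¹ ∈ Rist G J := h ▸ Rist_conj hg k

/-- An element supported off `I` preserves `I`. -/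
theorem Rist_smul_set {I J : Set X} {g : G} (hg : g ∈ Rist G J) (h : Disjoint I J) :
    g • I = I := by
  have h1 : ∀ x ∈ I, g • x = x := fun x hx => hg x (Set.disjoint_left.1 h hx)
  ext x
  constructor
  · rintro ⟨y, hy, rfl⟩
    simpa [h1 y hy] using hy
  · intro hx
    exact ⟨x, hx, h1 x hx⟩

end

namespace Crit
variable {G X : Type*} [Group G] [TopologicalSpace X] [MulAction G X] {𝓘 : Set (Set X)}

theorem ext (H : Crit G 𝓘) {g h : G} (e : ∀ x : X, g • x = h • x) : g = h := by
  have := H.faith (h⁻¹ * g) (fun x => by rw [mul_smul, e, inv_smul_smul])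
  exact (inv_mul_eq_one.1 this).symm

theorem commute (H : Crit G 𝓘) {I J : Set X} (hIJ : Disjoint I J) {g h : G}
    (hg : g ∈ Rist G I) (hh : h ∈ Rist G J) : Commute g h := by
  apply H.ext
  intro x
  rw [mul_smul, mul_smul]
  by_cases hx : x ∈ I
  · rw [hh x (Set.disjoint_left.1 hIJ hx),
      hh _ (Set.disjoint_left.1 hIJ (Rist_smul_mem hg hx))]
  · rw [hg x hx]
    by_cases hxJ : x ∈ J
    · rw [hg _ (Set.disjoint_right.1 hIJ (Rist_smul_mem hh hxJ))]
    · rw [hh x hxJ, hg x hx]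

theorem sub (H : Crit G 𝓘) {V : Set X} (hV : IsOpen V) (hn : V.Nonempty) :
    ∃ U ∈ 𝓘, U ⊆ V := by
  obtain ⟨x, hx⟩ := hn
  obtain ⟨U, hU, -, h⟩ := H.basis.exists_subset_of_mem_open hx hV
  exact ⟨U, hU, h⟩

theorem isOpen (H : Crit G 𝓘) {I : Set X} (hI : I ∈ 𝓘) : IsOpen I := (H.clopen I hI).2.2.2
theorem nonempty (H : Crit G 𝓘) {I : Set X} (hI : I ∈ 𝓘) : I.Nonempty := (H.clopen I hI).1

theorem exists_ne (H : Crit G 𝓘) {W : Set X} (hW : IsOpen W) (hn : W.Nonempty) (v : X) :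
    ∃ w ∈ W, w ≠ v := by
  by_contra! hc
  apply H.noiso v
  obtain ⟨w, hw⟩ := hn
  have : W = {v} := by
    ext z
    constructor
    · intro hz; exact hc z hz
    · rintro rfl; rw [← hc w hw]; exact hw
  rwa [← this]

theorem disj (H : Crit G 𝓘) {V W : Set X} (hV : IsOpen V) (hW : IsOpen W) (hVn : V.Nonempty)
    (hWn : W.Nonempty) : ∃ U ∈ 𝓘, ∃ U' ∈ 𝓘, U ⊆ V ∧ U' ⊆ W ∧ Disjoint U U' := by
  obtain ⟨v, hv⟩ := hVn
  obtain ⟨w, hw, hne⟩ := H.exists_ne hW hWn v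
  haveI := H.t2
  obtain ⟨A, B, hA, hB, hvA, hwB, hAB⟩ := t2_separation hne.symm
  obtain ⟨U, hU, hUs⟩ := H.sub (hV.inter hA) ⟨v, hv, hvA⟩
  obtain ⟨U', hU', hUs'⟩ := H.sub (hW.inter hB) ⟨w, hw, hwB⟩
  exact ⟨U, hU, U', hU', fun x hx => (hUs hx).1, fun x hx => (hUs' hx).1,
    hAB.mono (fun x hx => (hUs hx).2) (fun x hx => (hUs' hx).2)⟩

theorem disj3 (H : Crit G 𝓘) {V W Z : Set X} (hV : IsOpen V) (hW : IsOpen W) (hZ : IsOpen Z)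
    (hVn : V.Nonempty) (hWn : W.Nonempty) (hZn : Z.Nonempty) :
    ∃ U ∈ 𝓘, ∃ U' ∈ 𝓘, ∃ T ∈ 𝓘, U ⊆ V ∧ U' ⊆ W ∧ T ⊆ Z ∧ Disjoint U U' ∧ Disjoint U T ∧
      Disjoint U' T := by
  obtain ⟨U, hU, U', hU', s1, s2, d1⟩ := H.disj hV hW hVn hWn
  obtain ⟨U1, hU1, T, hT, s3, s4, d2⟩ := H.disj (H.isOpen hU) hZ (H.nonempty hU) hZn
  obtain ⟨U2, hU2, T2, hT2, s5, s6, d3⟩ :=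
    H.disj (H.isOpen hU') (H.isOpen hT) (H.nonempty hU') (H.nonempty hT)
  exact ⟨U1, hU1, U2, hU2, T2, hT2, s3.trans s1, s5.trans s2, s6.trans s4,
    d1.mono s3 s5, d2.mono_right s6, d3⟩

theorem three (H : Crit G 𝓘) : ∃ U ∈ 𝓘, ∃ U' ∈ 𝓘, ∃ T ∈ 𝓘, Disjoint U U' ∧ Disjoint U T ∧
      Disjoint U' T := by
  haveI := H.ne
  obtain ⟨U, hU, U', hU', T, hT, -, -, -, h⟩ := H.disj3 isOpen_univ isOpen_univ isOpen_univ
    Set.univ_nonempty Set.univ_nonempty (Set.univ_nonempty (α := X))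
  exact ⟨U, hU, U', hU', T, hT, h⟩

theorem trans1 (H : Crit G 𝓘) {I J : Set X} (hI : I ∈ 𝓘) (hJ : J ∈ 𝓘) :
    ∃ g : G, g • I = J := by
  have aux : ∀ I ∈ 𝓘, ∃ J K, I ∈ 𝓘 ∧ J ∈ 𝓘 ∧ K ∈ 𝓘 ∧ Disjoint I J ∧ Disjoint I K ∧
      Disjoint J K ∧ (∃ L ∈ 𝓘, Disjoint L (I ∪ J ∪ K)) := by
    intro I hI
    have hc := H.compl I hI
    obtain ⟨U, hU, U', hU', T, hT, s1, s2, s3, d1, d2, d3⟩ := H.disj3 (H.isOpen hc)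
      (H.isOpen hc) (H.isOpen hc) (H.nonempty hc) (H.nonempty hc) (H.nonempty hc)
    have h0 : Disjoint I Iᶜ := disjoint_compl_right
    refine ⟨U, U', hI, hU, hU', h0.mono_right s1, h0.mono_right s2, d1, T, hT, ?_⟩
    rw [Set.disjoint_union_right, Set.disjoint_union_right]
    exact ⟨⟨(h0.mono_right s3).symm, d2.symm⟩, d3.symm⟩
  obtain ⟨A, B, h1⟩ := aux I hI
  obtain ⟨A', B', h2⟩ := aux J hJ
  obtain ⟨g, hg, -⟩ := H.trans3 _ _ _ _ _ _ h1 h2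
  exact ⟨g, hg⟩

theorem glue (H : Crit G 𝓘) (f f' : X → X) (h1 : ∀ x, f' (f x) = x) (h2 : ∀ x, f (f' x) = x)
    (hf : ∀ x : X, ∃ U : Set X, IsOpen U ∧ x ∈ U ∧ ∃ g : G, ∀ y ∈ U, f y = g • y)
    (hf' : ∀ x : X, ∃ U : Set X, IsOpen U ∧ x ∈ U ∧ ∃ g : G, ∀ y ∈ U, f' y = g • y) :
    ∃ g : G, ∀ x, g • x = f x := by
  have hc : ∀ f : X → X,
      (∀ x : X, ∃ U : Set X, IsOpen U ∧ x ∈ U ∧ ∃ g : G, ∀ y ∈ U, f y = g • y) →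
      Continuous f := by
    intro f hf
    rw [continuous_iff_continuousAt]
    intro x
    obtain ⟨U, hU, hx, g, hg⟩ := hf x
    refine (H.cont g).continuousAt.congr ?_
    filter_upwards [hU.mem_nhds hx] with y hy
    exact (hg y hy).symm
  exact H.full ⟨⟨f, f', h1, h2⟩, hc f hf, hc f' hf'⟩ hf

theorem isClopen_smul (H : Crit G 𝓘) {U : Set X} (hU : IsClopen U) (g : G) :
    IsClopen (g • U) := by
  have : g • U = (fun x : X => g⁻¹ • x) ⁻¹' U := by
    ext x; rw [Set.mem_smul_set_iff_inv_smul_mem]; rfl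
  rw [this]
  exact hU.preimage (H.cont _)

theorem swap (H : Crit G 𝓘) (g : G) {U : Set X} (hU : IsClopen U)
    (hg : (∀ u ∈ U, g • u = u) ∨ Disjoint (g • U) U) :
    ∃ σ : G, σ * σ = 1 ∧ (∀ u ∈ U, σ • g • u = u) ∧ σ ∈ Rist G (U ∪ g • U) := by
  classical
  rcases hg with hg | hg
  · exact ⟨1, by simp, fun u hu => by rw [one_smul, hg u hu], Subgroup.one_mem _⟩
  set f : X → X := fun x => if x ∈ U then g • x else if x ∈ g • U then g⁻¹ • x else x with hfdef
  have fU : ∀ x ∈ U, f x = g • x := fun x hx => by simp [hfdef, hx]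
  have fgU : ∀ x ∈ g • U, f x = g⁻¹ • x := fun x hx => by
    simp [hfdef, hx, Set.disjoint_left.1 hg hx]
  have fo : ∀ x, x ∉ U ∪ g • U → f x = x := fun x hx => by
    simp only [Set.mem_union, not_or] at hx
    simp [hfdef, hx.1, hx.2]
  have hgU := H.isClopen_smul hU g
  have ff : ∀ x, f (f x) = x := by
    intro x
    by_cases hx : x ∈ U
    · rw [fU x hx, fgU _ (Set.smul_mem_smul_set hx), inv_smul_smul]
    by_cases hx' : x ∈ g • U
    · rw [fgU x hx', fU _ (Set.mem_smul_set_iff_inv_smul_mem.1 hx'), smul_inv_smul]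
    have : x ∉ U ∪ g • U := by simp [hx, hx']
    rw [fo x this, fo x this]
  have loc : ∀ x : X, ∃ V : Set X, IsOpen V ∧ x ∈ V ∧ ∃ g : G, ∀ y ∈ V, f y = g • y := by
    intro x
    by_cases hx : x ∈ U
    · exact ⟨U, hU.2, hx, g, fU⟩
    by_cases hx' : x ∈ g • U
    · exact ⟨_, hgU.2, hx', g⁻¹, fgU⟩
    have : x ∉ U ∪ g • U := by simp [hx, hx']
    exact ⟨(U ∪ g • U)ᶜ, (hU.union hgU).compl.2, this, 1, fun y hy => by rw [fo y hy, one_smul]⟩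
  obtain ⟨σ, hσ⟩ := H.glue f f ff ff loc loc
  refine ⟨σ, H.ext fun x => ?_, fun u hu => ?_, fun x hx => ?_⟩
  · rw [mul_smul, hσ, hσ, ff, one_smul]
  · rw [hσ, fgU _ (Set.smul_mem_smul_set hu), inv_smul_smul]
  · rw [hσ, fo x hx]

theorem cut (H : Crit G 𝓘) (g : G) {A : Set X} (hA : IsClopen A) (hg : g • A = A) :
    ∃ c : G, c ∈ Rist G Aᶜ ∧ ∀ x ∉ A, c • x = g • x := by
  classical
  have hm : ∀ x, g • x ∈ A ↔ x ∈ A := by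
    intro x
    conv_lhs => rw [← hg]
    exact Set.smul_mem_smul_set_iff
  have hm' : ∀ x, g⁻¹ • x ∈ A ↔ x ∈ A := by
    intro x
    rw [← hm, smul_inv_smul]
  have loc : ∀ g : G, ∀ x : X, ∃ V : Set X, IsOpen V ∧ x ∈ V ∧ ∃ h : G, ∀ y ∈ V,
      (if y ∈ A then y else g • y) = h • y := by
    intro g x
    by_cases hx : x ∈ A
    · exact ⟨A, hA.2, hx, 1, fun y hy => by simp [hy]⟩
    · exact ⟨Aᶜ, hA.compl.2, hx, g, fun y hy => by simp [show y ∉ A from hy]⟩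
  obtain ⟨c, hc⟩ := H.glue (fun x => if x ∈ A then x else g • x)
    (fun x => if x ∈ A then x else g⁻¹ • x)
    (fun x => by by_cases hx : x ∈ A <;> simp [hx, hm])
    (fun x => by by_cases hx : x ∈ A <;> simp [hx, hm']) (loc g) (loc g⁻¹)
  refine ⟨c, fun x hx => ?_, fun x hx => ?_⟩
  · rw [hc, if_pos (by simpa using hx)]
  · rw [hc, if_neg hx]

theorem good (H : Crit G 𝓘) (F : Finset G) {V T₀ : Set X} (hV : IsOpen V) (hT₀ : IsOpen T₀)
    (hVn : V.Nonempty) (hTn : T₀.Nonempty) :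
    ∃ U ∈ 𝓘, ∃ T ∈ 𝓘, U ⊆ V ∧ T ⊆ T₀ ∧ Disjoint U T ∧
      ∀ s ∈ F, ((∀ u ∈ U, s • u = u) ∨ Disjoint (s • U) U) ∧ Disjoint (s • U) T := by
  classical
  haveI := H.t2
  induction F using Finset.induction_on with
  | empty =>
    obtain ⟨U, hU, T, hT, h1, h2, h3⟩ := H.disj hV hT₀ hVn hTn
    exact ⟨U, hU, T, hT, h1, h2, h3, by simp⟩
  | insert s F hs ih =>
    obtain ⟨U, hU, T, hT, h1, h2, h3, h4⟩ := ih
    -- first shrink `U`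
    have step1 : ∃ U1 ∈ 𝓘, U1 ⊆ U ∧ ((∀ u ∈ U1, s • u = u) ∨ Disjoint (s • U1) U1) := by
      by_cases hid : ∀ u ∈ U, s • u = u
      · exact ⟨U, hU, subset_rfl, Or.inl hid⟩
      push Not at hid
      obtain ⟨u, hu, hne⟩ := hid
      obtain ⟨A, B, hA, hB, huA, huB, hAB⟩ := t2_separation hne
      obtain ⟨U1, hU1, hs1⟩ := H.sub (((H.isOpen hU).inter hB).inter (hA.preimage (H.cont s)))
        ⟨u, ⟨hu, huB⟩, huA⟩
      refine ⟨U1, hU1, fun x hx => (hs1 hx).1.1, Or.inr ?_⟩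
      rw [Set.disjoint_left]
      rintro _ ⟨y, hy, rfl⟩ hy'
      exact Set.disjoint_left.1 hAB (hs1 hy).2 (hs1 hy').1.2
    obtain ⟨U1, hU1, hs1, hg⟩ := step1
    obtain ⟨u, hu⟩ := H.nonempty hU1
    obtain ⟨t, ht, hne⟩ := H.exists_ne (H.isOpen hT) (H.nonempty hT) (s • u)
    obtain ⟨A, B, hA, hB, htA, huB, hAB⟩ := t2_separation hne
    obtain ⟨U2, hU2, hs2⟩ := H.sub ((H.isOpen hU1).inter (hB.preimage (H.cont s))) ⟨u, hu, huB⟩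
    obtain ⟨T2, hT2, hsT⟩ := H.sub ((H.isOpen hT).inter hA) ⟨t, ht, htA⟩
    have i1 : U2 ⊆ U1 := fun x hx => (hs2 hx).1
    have i2 : T2 ⊆ T := fun x hx => (hsT hx).1
    have mono : ∀ s : G, ∀ A B : Set X, A ⊆ B →
        ((∀ u ∈ B, s • u = u) ∨ Disjoint (s • B) B) →
        ((∀ u ∈ A, s • u = u) ∨ Disjoint (s • A) A) := by
      intro s A B hAB h
      rcases h with h | h
      · exact Or.inl fun u hu => h u (hAB hu)
      · exact Or.inr (h.mono (Set.smul_set_mono hAB) hAB)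
    refine ⟨U2, hU2, T2, hT2, (i1.trans hs1).trans h1, i2.trans h2,
      h3.mono (i1.trans hs1) i2, ?_⟩
    intro r hr
    rcases Finset.mem_insert.1 hr with rfl | hr
    · refine ⟨mono _ _ _ i1 hg, ?_⟩
      rw [Set.disjoint_left]
      rintro _ ⟨y, hy, rfl⟩ hy'
      exact Set.disjoint_left.1 hAB (hsT hy').2 (hs2 hy).2
    · exact ⟨mono _ _ _ (i1.trans hs1) (h4 r hr).1,
        (h4 r hr).2.mono (Set.smul_set_mono (i1.trans hs1)) i2⟩

/-! ### Quasimorphisms on `G` -/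

theorem HQ_rist (H : Crit G 𝓘) {Φ : G → ℝ} {D : ℝ} (hΦ : HQ Φ D) {I : Set X} (hI : I ∈ 𝓘)
    {g h : G} (hg : g ∈ Rist G I) (hh : h ∈ Rist G I) : Φ (g * h) = Φ g + Φ h := by
  have key : ∀ n : ℕ, ∀ I ∈ 𝓘, ∀ g ∈ Rist G I, ∀ h ∈ Rist G I,
      2 ^ n * |Φ (g * h) - Φ g - Φ h| ≤ D := by
    intro n
    induction n with
    | zero => intro I _ g _ h _; simpa using hΦ.defect g h
    | succ n ih =>
      intro I hI g hg h hh
      obtain ⟨I1, hI1, I2, hI2, T, hT, d1, d2, d3⟩ := H.three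
      obtain ⟨k1, hk1⟩ := H.trans1 hI hI1
      obtain ⟨k2, hk2⟩ := H.trans1 hI hI2
      have m1 : ∀ f ∈ Rist G I, k1 * f * k1⁻¹ ∈ Rist G I1 := fun f hf => Rist_conj_eq hf hk1
      have m2 : ∀ f ∈ Rist G I, k2 * f * k2⁻¹ ∈ Rist G I2 := fun f hf => Rist_conj_eq hf hk2
      have i1 : I1 ⊆ Tᶜ := Set.subset_compl_iff_disjoint_right.2 d2
      have i2 : I2 ⊆ Tᶜ := Set.subset_compl_iff_disjoint_right.2 d3
      have val : ∀ f ∈ Rist G I, Φ ((k1 * f * k1⁻¹) * (k2 * f * k2⁻¹)) = 2 * Φ f := by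
        intro f hf
        rw [hΦ.comm _ _ (H.commute d1 (m1 f hf) (m2 f hf)), hΦ.conj, hΦ.conj]; ring
      have mem : ∀ f ∈ Rist G I, (k1 * f * k1⁻¹) * (k2 * f * k2⁻¹) ∈ Rist G Tᶜ := fun f hf =>
        Subgroup.mul_mem _ (Rist_mono i1 (m1 f hf)) (Rist_mono i2 (m2 f hf))
      have e : ((k1 * g * k1⁻¹) * (k2 * g * k2⁻¹)) * ((k1 * h * k1⁻¹) * (k2 * h * k2⁻¹)) =
          (k1 * (g * h) * k1⁻¹) * (k2 * (g * h) * k2⁻¹) := by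
        have c := (H.commute d1 (m1 h hh) (m2 g hg)).eq
        calc _ = (k1 * g * k1⁻¹) * ((k2 * g * k2⁻¹) * (k1 * h * k1⁻¹)) * (k2 * h * k2⁻¹) := by
              group
          _ = (k1 * g * k1⁻¹) * ((k1 * h * k1⁻¹) * (k2 * g * k2⁻¹)) * (k2 * h * k2⁻¹) := by
              rw [c]
          _ = _ := by group
      have := ih Tᶜ (H.compl T hT) _ (mem g hg) _ (mem h hh)
      rw [e, val _ (Subgroup.mul_mem _ hg hh), val _ hg, val _ hh] at this
      rw [show 2 * Φ (g * h) - 2 * Φ g - 2 * Φ h = 2 * (Φ (g * h) - Φ g - Φ h) by ring, abs_mul,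
        abs_of_pos (by norm_num : (0 : ℝ) < 2)] at this
      rw [pow_succ]; linarith
  have h0 : Φ (g * h) - Φ g - Φ h = 0 := by
    apply eq_of_mul_bdd (D := D)
    intro n
    refine le_trans ?_ (key n I hI g hg h hh)
    gcongr
    exact_mod_cast Nat.lt_two_pow_self.le
  linarith

theorem HQ_bdd (H : Crit G 𝓘) (hab : Finite (Abelianization G)) {Φ : G → ℝ} {D : ℝ}
    (hΦ : HQ Φ D) (g : G) : |Φ g| ≤ D := by
  classical
  haveI := H.ne
  have ex : ∀ F : Finset G, ∃ U ∈ 𝓘, ∃ T ∈ 𝓘, Disjoint U T ∧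
      ∀ s ∈ F, ((∀ u ∈ U, s • u = u) ∨ Disjoint (s • U) U) ∧ Disjoint (s • U) T := by
    intro F
    obtain ⟨U, hU, T, hT, -, -, h⟩ := H.good F isOpen_univ isOpen_univ
      (Set.univ_nonempty (α := X)) Set.univ_nonempty
    exact ⟨U, hU, T, hT, h⟩
  choose U hU T hT hUT hF using ex
  have ex2 : ∀ (F : Finset G) (g : G), ∃ σ : G, σ * σ = 1 ∧
      (g ∈ F → (∀ u ∈ U F, σ • g • u = u) ∧ σ ∈ Rist G (U F ∪ g • U F)) := by
    intro F g
    by_cases hg : g ∈ F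
    · obtain ⟨σ, h1, h2⟩ := H.swap g (H.clopen _ (hU F)).2.2 (hF F g hg).1
      exact ⟨σ, h1, fun _ => h2⟩
    · exact ⟨1, by simp, fun h => absurd h hg⟩
  choose σ hσ1 hσ2 using ex2
  set 𝒰 : Ultrafilter (Finset G) := Ultrafilter.of atTop
  have hle : (𝒰 : Filter (Finset G)) ≤ atTop := Ultrafilter.of_le atTop
  have close : ∀ F g, |Φ (σ F g * g) - Φ g| ≤ D := by
    intro F g
    have := hΦ.defect (σ F g) g
    rw [hΦ.invol _ (hσ1 F g)] at this
    rwa [sub_zero] at this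
  have exl : ∀ g, ∃ l, Tendsto (fun F => Φ (σ F g * g)) 𝒰 (𝓝 l) := by
    intro g
    apply exists_ulim 𝒰 _ (|Φ g| + D)
    filter_upwards with F
    have := close F g
    have h2 := abs_add_le (Φ (σ F g * g) - Φ g) (Φ g)
    rw [sub_add_cancel] at h2
    linarith
  choose Ψ hΨ using exl
  have near : ∀ g, |Ψ g - Φ g| ≤ D := fun g =>
    le_of_tendsto ((hΨ g).sub_const (Φ g)).abs (Eventually.of_forall fun F => close F g)
  have hmul : ∀ g h, Ψ (g * h) = Ψ g + Ψ h := by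
    intro g h
    refine tendsto_nhds_unique (hΨ (g * h)) (((hΨ g).add (hΨ h)).congr' (hle ?_))
    filter_upwards [eventually_ge_atTop ({g, h, g * h} : Finset G)] with F hFs
    have mg : g ∈ F := hFs (by simp)
    have mh : h ∈ F := hFs (by simp)
    have mgh : g * h ∈ F := hFs (by simp)
    obtain ⟨a1, a2⟩ := hσ2 F g mg
    obtain ⟨b1, b2⟩ := hσ2 F h mh
    obtain ⟨c1, c2⟩ := hσ2 F (g * h) mgh
    set V := U F
    have d0 : Disjoint V (T F) := hUT F
    have d1 := (hF F g mg).2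
    have d3 := (hF F (g * h) mgh).2
    have fixm : ∀ k : G, (∀ u ∈ V, k • u = u) → k ∈ Rist G Vᶜ := fun k hk x hx =>
      hk x (by simpa using hx)
    have bg : σ F g * g ∈ Rist G Vᶜ := fixm _ fun u hu => by rw [mul_smul, a1 u hu]
    have bh : σ F h * h ∈ Rist G Vᶜ := fixm _ fun u hu => by rw [mul_smul, b1 u hu]
    have bgh : σ F (g * h) * (g * h) ∈ Rist G Vᶜ :=
      fixm _ fun u hu => by rw [mul_smul, c1 u hu]
    have s1 : σ F g ∈ Rist G (T F)ᶜ := Rist_mono (Set.union_subset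
      (Set.subset_compl_iff_disjoint_right.2 d0) (Set.subset_compl_iff_disjoint_right.2 d1)) a2
    have s2 : σ F (g * h) ∈ Rist G (T F)ᶜ := Rist_mono (Set.union_subset
      (Set.subset_compl_iff_disjoint_right.2 d0) (Set.subset_compl_iff_disjoint_right.2 d3)) c2
    have s3 : g * σ F h * g⁻¹ ∈ Rist G (T F)ᶜ := by
      refine Rist_mono ?_ (Rist_conj b2 g)
      rw [Set.smul_set_union, ← mul_smul]
      exact Set.union_subset
        (Set.subset_compl_iff_disjoint_right.2 d1) (Set.subset_compl_iff_disjoint_right.2 d3)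
    have hT' := H.compl _ (hT F)
    have hV' := H.compl _ (hU F)
    set r := σ F (g * h) * (g * σ F h * g⁻¹) * σ F g with hr
    have r0 : Φ r = 0 := by
      rw [hr, H.HQ_rist hΦ hT' (Subgroup.mul_mem _ s2 s3) s1, H.HQ_rist hΦ hT' s2 s3, hΦ.conj,
        hΦ.invol _ (hσ1 F g), hΦ.invol _ (hσ1 F h), hΦ.invol _ (hσ1 F (g * h))]
      simp
    have e : σ F (g * h) * (g * h) = r * ((σ F g * g) * (σ F h * h)) := by
      have q1 := hσ1 F g
      have q2 := hσ1 F h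
      have q3 : σ F h * g⁻¹ * 1 * g * σ F h = 1 := by
        rw [mul_one, inv_mul_cancel_right]; exact q2
      calc σ F (g * h) * (g * h) = σ F (g * h) * g * 1 * h := by group
        _ = σ F (g * h) * g * (σ F h * g⁻¹ * 1 * g * σ F h) * h := by rw [q3]
        _ = σ F (g * h) * g * (σ F h * g⁻¹ * (σ F g * σ F g) * g * σ F h) * h := by rw [q1]
        _ = _ := by rw [hr]; simp only [mul_assoc]
    have hr' : r ∈ Rist G Vᶜ := by
      have : r = σ F (g * h) * (g * h) * ((σ F g * g) * (σ F h * h))⁻¹ := by rw [e]; group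
      rw [this]
      exact Subgroup.mul_mem _ bgh (Subgroup.inv_mem _ (Subgroup.mul_mem _ bg bh))
    rw [e, H.HQ_rist hΦ hV' hr' (Subgroup.mul_mem _ bg bh), r0,
      H.HQ_rist hΦ hV' bg bh, zero_add]
  have hz : Ψ g = 0 := by
    let f : G →* Multiplicative ℝ :=
      MonoidHom.mk' (fun g => Multiplicative.ofAdd (Ψ g)) (fun a b => by rw [hmul]; rfl)
    obtain ⟨n, hn, hpow⟩ := (isOfFinOrder_of_finite (Abelianization.of g)).exists_pow_eq_one
    have h1 : (Abelianization.lift f) (Abelianization.of g) ^ n = 1 := by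
      rw [← map_pow, hpow, map_one]
    rw [Abelianization.lift_apply_of] at h1
    have h2 : (n : ℝ) * Ψ g = 0 := by
      have := congrArg Multiplicative.toAdd h1
      simpa [f, toAdd_pow] using this
    rcases mul_eq_zero.1 h2 with h3 | h3
    · exfalso; have : n = 0 := by exact_mod_cast h3
      omega
    · exact h3
  have := near g
  rw [hz, zero_sub, abs_neg] at this
  exact this

end Crit
end NLAux
namespace NLAux
open Filter Topology
open scoped Pointwise

/-! ### Finite index normal subgroups -/

namespace Crit
variable {G X : Type*} [Group G] [TopologicalSpace X] [MulAction G X] {𝓘 : Set (Set X)}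

theorem dec (H : Crit G 𝓘) (N : Subgroup G) [N.Normal] [N.FiniteIndex] {J : Set X}
    (hJ : J ∈ 𝓘) (g : G) : ∃ n ∈ N, ∃ k ∈ Rist G J, g = n * k := by
  haveI := H.ne
  haveI : Finite (G ⧸ N) := Subgroup.finite_quotient_of_finiteIndex
  let Q : Set X → Subgroup (G ⧸ N) := fun J => (Rist G J).map (QuotientGroup.mk' N)
  have mono : ∀ J J' : Set X, J ⊆ J' → Q J ≤ Q J' := fun J J' h =>
    Subgroup.map_mono (Rist_mono h)
  have card : ∀ J ∈ 𝓘, ∀ J' ∈ 𝓘, (Q J : Set (G ⧸ N)).ncard ≤ (Q J' : Set (G ⧸ N)).ncard := by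
    intro J hJ J' hJ'
    obtain ⟨k, hk⟩ := H.trans1 hJ hJ'
    have hinj : Function.Injective
        (fun x : G ⧸ N => QuotientGroup.mk' N k * x * (QuotientGroup.mk' N k)⁻¹) := by
      intro x y h
      simpa using h
    rw [← Set.ncard_image_of_injective _ hinj]
    refine Set.ncard_le_ncard ?_ (Set.toFinite _)
    rintro _ ⟨_, ⟨f, hf, rfl⟩, rfl⟩
    refine ⟨k * f * k⁻¹, Rist_conj_eq hf hk, ?_⟩
    simp
  have eqs : ∀ J ∈ 𝓘, ∀ J' ∈ 𝓘, J ⊆ J' → Q J = Q J' := fun J hJ J' hJ' h =>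
    SetLike.coe_injective (Set.eq_of_subset_of_ncard_le (mono J J' h) (card J' hJ' J hJ)
      (Set.toFinite _))
  have alleq : ∀ J ∈ 𝓘, ∀ J' ∈ 𝓘, Q J = Q J' := by
    intro J hJ J' hJ'
    obtain ⟨U, hU, U', hU', T, hT, s1, s2, -, -, d2, d3⟩ := H.disj3 (H.isOpen hJ)
      (H.isOpen hJ') (isOpen_univ (X := X)) (H.nonempty hJ) (H.nonempty hJ') Set.univ_nonempty
    have i1 : U ⊆ Tᶜ := Set.subset_compl_iff_disjoint_right.2 d2
    have i2 : U' ⊆ Tᶜ := Set.subset_compl_iff_disjoint_right.2 d3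
    rw [← eqs U hU J hJ s1, ← eqs U' hU' J' hJ' s2, eqs U hU _ (H.compl T hT) i1,
      eqs U' hU' _ (H.compl T hT) i2]
  have hmem : QuotientGroup.mk' N g ∈ Q J := by
    obtain ⟨U, hU, T, hT, -, -, d, hg⟩ := H.good {g} isOpen_univ isOpen_univ
      (Set.univ_nonempty (α := X)) Set.univ_nonempty
    obtain ⟨hg1, hg2⟩ := hg g (by simp)
    obtain ⟨σ, hσ1, hσ2, hσ3⟩ := H.swap g (H.clopen U hU).2.2 hg1
    have m1 : QuotientGroup.mk' N σ ∈ Q J := by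
      rw [alleq J hJ _ (H.compl T hT)]
      exact ⟨σ, Rist_mono (Set.union_subset (Set.subset_compl_iff_disjoint_right.2 d)
        (Set.subset_compl_iff_disjoint_right.2 hg2)) hσ3, rfl⟩
    have m2 : QuotientGroup.mk' N (σ * g) ∈ Q J := by
      rw [alleq J hJ _ (H.compl U hU)]
      exact ⟨σ * g, fun x hx => by rw [mul_smul, hσ2 x (by simpa using hx)], rfl⟩
    have : QuotientGroup.mk' N g = (QuotientGroup.mk' N σ)⁻¹ * QuotientGroup.mk' N (σ * g) := by
      rw [map_mul]; group
    rw [this]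
    exact Subgroup.mul_mem _ (Subgroup.inv_mem _ m1) m2
  obtain ⟨k, hk, e⟩ := hmem
  refine ⟨g * k⁻¹, ?_, k, hk, by group⟩
  rw [← div_eq_mul_inv]
  exact QuotientGroup.eq_iff_div_mem.1 e.symm

theorem transN (H : Crit G 𝓘) (N : Subgroup G) [N.Normal] [N.FiniteIndex] {I J : Set X}
    (hI : I ∈ 𝓘) (hJ : J ∈ 𝓘) : ∃ n ∈ N, n • I = J := by
  obtain ⟨g, hg⟩ := H.trans1 hI hJ
  obtain ⟨n, hn, k, hk, rfl⟩ := H.dec N (H.compl I hI) g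
  refine ⟨n, hn, ?_⟩
  rwa [mul_smul, Rist_smul_set hk disjoint_compl_right] at hg

theorem gen (H : Crit G 𝓘) (N : Subgroup G) [N.Normal] [N.FiniteIndex] {P1 P2 P3 : Set X}
    (h1 : P1 ∈ 𝓘) (h2 : P2 ∈ 𝓘) (h3 : P3 ∈ 𝓘) (d12 : Disjoint P1 P2) (d13 : Disjoint P1 P3)
    (d23 : Disjoint P2 P3) (g : G) (hg : g ∈ N) :
    ∃ a ∈ N, ∃ c ∈ N, ∃ b ∈ N, (a ∈ Rist G P1ᶜ ∨ a ∈ Rist G P2ᶜ) ∧ c ∈ Rist G P1ᶜ ∧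
      b ∈ Rist G P3ᶜ ∧ g = a * c⁻¹ * b * c := by
  -- first factor
  have fac : ∀ P ∈ 𝓘, Disjoint P P3 → (∃ x ∈ P3, g • x ∉ P) →
      ∃ U ∈ 𝓘, U ⊆ P3 ∧ ∃ a ∈ N, a ∈ Rist G Pᶜ ∧ a⁻¹ * g ∈ Rist G Uᶜ := by
    rintro P hP dP ⟨x, hx, hgx⟩
    have hPc := H.compl P hP
    obtain ⟨U, hU, S, hS, s1, s2, d, hgood⟩ := H.good {g}
      ((H.isOpen h3).inter ((H.isOpen hPc).preimage (H.cont g))) (H.isOpen hPc)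
      ⟨x, hx, hgx⟩ (H.nonempty hPc)
    obtain ⟨g1, g2⟩ := hgood g (by simp)
    obtain ⟨σ, hσ1, hσ2, hσ3⟩ := H.swap g (H.clopen U hU).2.2 g1
    obtain ⟨n, hn, k, hk, e⟩ := H.dec N hS σ
    have en : n = σ * k⁻¹ := by rw [e]; group
    have i1 : U ∪ g • U ⊆ Pᶜ := by
      refine Set.union_subset (fun y hy hyP => Set.disjoint_left.1 dP hyP (s1 hy).1) ?_
      rintro _ ⟨y, hy, rfl⟩
      exact (s1 hy).2
    refine ⟨U, hU, fun y hy => (s1 hy).1, n, hn, ?_, ?_⟩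
    · rw [en]
      exact Subgroup.mul_mem _ (Rist_mono i1 hσ3) (Subgroup.inv_mem _ (Rist_mono s2 hk))
    · intro u hu
      have hu : u ∈ U := by simpa using hu
      have eσ : σ⁻¹ = σ := inv_eq_of_mul_eq_one_left hσ1
      rw [en, mul_inv_rev, inv_inv, eσ, mul_smul, mul_smul, hσ2 u hu]
      exact hk u (Set.disjoint_left.1 d hu)
  have fac' : ∃ U ∈ 𝓘, U ⊆ P3 ∧ ∃ a ∈ N, (a ∈ Rist G P1ᶜ ∨ a ∈ Rist G P2ᶜ) ∧
      a⁻¹ * g ∈ Rist G Uᶜ := by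
    obtain ⟨x, hx⟩ := H.nonempty h3
    by_cases hgx : g • x ∈ P1
    · obtain ⟨U, hU, hs, a, ha, ha', hb⟩ :=
        fac P2 h2 d23 ⟨x, hx, Set.disjoint_left.1 d12 hgx⟩
      exact ⟨U, hU, hs, a, ha, Or.inr ha', hb⟩
    · obtain ⟨U, hU, hs, a, ha, ha', hb⟩ := fac P1 h1 d13 ⟨x, hx, hgx⟩
      exact ⟨U, hU, hs, a, ha, Or.inl ha', hb⟩
  obtain ⟨U, hU, hs, a, ha, ha', hb⟩ := fac'
  obtain ⟨K, hK, L, hL, sK, sL, dKL⟩ := H.disj (H.isOpen h2) (H.isOpen h2) (H.nonempty h2)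
    (H.nonempty h2)
  have tup : ∀ U ∈ 𝓘, U ⊆ P3 → U ∈ 𝓘 ∧ P1 ∈ 𝓘 ∧ K ∈ 𝓘 ∧ Disjoint U P1 ∧ Disjoint U K ∧
      Disjoint P1 K ∧ (∃ L ∈ 𝓘, Disjoint L (U ∪ P1 ∪ K)) := by
    intro U hU hs
    refine ⟨hU, h1, hK, (d13.mono_right hs).symm, (d23.mono sK hs).symm, d12.mono_right sK,
      L, hL, ?_⟩
    rw [Set.disjoint_union_right, Set.disjoint_union_right]
    exact ⟨⟨d23.mono sL hs, (d12.mono_right sL).symm⟩, dKL.symm⟩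
  obtain ⟨g0, e1, e2, -⟩ := H.trans3 _ _ _ _ _ _ (tup U hU hs) (tup P3 h3 subset_rfl)
  obtain ⟨c0, hc0, hc0'⟩ := H.cut g0 (H.clopen P1 h1).2.2 e2
  have ec0 : c0 • U = P3 := by
    rw [← e1]
    exact Set.image_congr fun x hx => hc0' x (Set.disjoint_right.1 d13 (hs hx))
  obtain ⟨c, hc, k, hk, e⟩ := H.dec N h2 c0
  have ec : c = c0 * k⁻¹ := by rw [e]; group
  have hcU : c • U = P3 := by
    rw [ec, mul_smul, Rist_smul_set (Subgroup.inv_mem _ hk) (d23.mono_right hs).symm, ec0]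
  refine ⟨a, ha, c, hc, c * (a⁻¹ * g) * c⁻¹, ?_, ha', ?_, ?_, by group⟩
  · exact Subgroup.mul_mem _ (Subgroup.mul_mem _ hc (Subgroup.mul_mem _ (Subgroup.inv_mem _ ha)
      hg)) (Subgroup.inv_mem _ hc)
  · rw [ec]
    exact Subgroup.mul_mem _ hc0 (Subgroup.inv_mem _
      (Rist_mono (Set.subset_compl_iff_disjoint_left.2 d12) hk))
  · refine Rist_conj_eq hb ?_
    rw [Set.smul_set_compl, hcU]

end Crit

/-- Homogeneous quasimorphism on the subgroup `N`, as a function on `G`. -/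
structure HQN {G : Type*} [Group G] (N : Subgroup G) (P : G → ℝ) (D : ℝ) : Prop where
  comm : ∀ g ∈ N, ∀ h ∈ N, Commute g h → P (g * h) = P g + P h
  conj : ∀ g ∈ N, ∀ k ∈ N, P (k * g * k⁻¹) = P g
  defect : ∀ g ∈ N, ∀ h ∈ N, |P (g * h) - P g - P h| ≤ D

namespace HQN
variable {G : Type*} [Group G] {N : Subgroup G} {P : G → ℝ} {D : ℝ}

theorem one (h : HQN N P D) : P 1 = 0 := by
  have := h.comm 1 N.one_mem 1 N.one_mem (Commute.refl _)
  simp only [mul_one] at this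
  linarith

theorem inv (h : HQN N P D) {g : G} (hg : g ∈ N) : P g⁻¹ = - P g := by
  have := h.comm g hg g⁻¹ (N.inv_mem hg) (Commute.inv_right (Commute.refl g))
  rw [mul_inv_cancel, h.one] at this
  linarith

theorem pow (h : HQN N P D) {g : G} (hg : g ∈ N) (n : ℕ) : P (g ^ n) = n * P g := by
  induction n with
  | zero => simp [h.one]
  | succ n ih =>
    rw [pow_succ, h.comm _ (N.pow_mem hg n) _ hg (Commute.pow_left (Commute.refl g) n), ih]
    push_cast; ring

end HQN

namespace Crit
variable {G X : Type*} [Group G] [TopologicalSpace X] [MulAction G X] {𝓘 : Set (Set X)}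

theorem HQN_conj (H : Crit G 𝓘) {N : Subgroup G} [N.Normal] [N.FiniteIndex] {P : G → ℝ} {D : ℝ}
    (hP : HQN N P D) {g : G} (hg : g ∈ N) (k : G) : P (k * g * k⁻¹) = P g := by
  haveI := H.t2
  have hD : 0 ≤ D := (abs_nonneg _).trans (hP.defect 1 N.one_mem 1 N.one_mem)
  have nc : ∀ g ∈ N, ∀ k : G, k * g * k⁻¹ ∈ N := fun g hg k =>
    Subgroup.Normal.conj_mem inferInstance g hg k
  have bd : ∀ g ∈ N, |P (k * g * k⁻¹) - P g| ≤ D := by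
    intro g hg
    by_cases h1 : g = 1
    · subst h1; simpa using hD
    have : ∃ x : X, g • x ≠ x := by
      by_contra! hc
      exact h1 (H.faith g hc)
    obtain ⟨u, hne⟩ := this
    obtain ⟨A, B, hA, hB, huA, huB, hAB⟩ := t2_separation hne
    obtain ⟨J, hJ, hs⟩ := H.sub (hB.inter (hA.preimage (H.cont g))) ⟨u, huB, huA⟩
    have dJ : Disjoint J (g • J) := by
      rw [Set.disjoint_right]
      rintro _ ⟨y, hy, rfl⟩ hy'
      exact Set.disjoint_left.1 hAB (hs hy).2 (hs hy').1
    obtain ⟨n, hn, k', hk', rfl⟩ := H.dec N hJ k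
    have e1 : n * k' * g * (n * k')⁻¹ = n * (k' * g * k'⁻¹) * n⁻¹ := by group
    rw [e1, hP.conj _ (nc g hg k') n hn]
    set w := k' * (g * k'⁻¹ * g⁻¹) with hw
    have hwN : w ∈ N := by
      have : w = (k' * g * k'⁻¹) * g⁻¹ := by rw [hw]; group
      rw [this]
      exact N.mul_mem (nc g hg k') (N.inv_mem hg)
    have e2 : k' * g * k'⁻¹ = w * g := by rw [hw]; group
    obtain ⟨m, hm, -, hmN⟩ := Subgroup.exists_pow_mem_of_index_ne_zero
      (H := N) Subgroup.FiniteIndex.index_ne_zero k'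
    have hcom : Commute k' (g * k'⁻¹ * g⁻¹) :=
      H.commute dJ hk' (Rist_conj (Subgroup.inv_mem _ hk') g)
    have e3 : w ^ m = k' ^ m * (g * (k' ^ m)⁻¹ * g⁻¹) := by
      rw [hw, hcom.mul_pow, conj_pow, inv_pow]
    have hw0 : P w = 0 := by
      have h2 := hP.pow hwN m
      have hcm : Commute (k' ^ m) (g * (k' ^ m)⁻¹ * g⁻¹) := by
        have := hcom.pow_pow m m
        rwa [conj_pow, inv_pow] at this
      rw [e3, hP.comm _ hmN _ (nc _ (N.inv_mem hmN) g) hcm, hP.conj _ (N.inv_mem hmN) g hg,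
        hP.inv hmN, add_neg_cancel] at h2
      rcases mul_eq_zero.1 h2.symm with h3 | h3
      · exfalso
        have : m = 0 := by exact_mod_cast h3
        omega
      · exact h3
    have := hP.defect w hwN g hg
    rw [hw0, sub_zero] at this
    rw [e2]
    convert this using 2
  have : P (k * g * k⁻¹) - P g = 0 := by
    apply eq_of_mul_bdd (D := D)
    intro i
    have := bd (g ^ i) (N.pow_mem hg i)
    rw [← conj_pow, hP.pow (nc g hg k), hP.pow hg, ← mul_sub, abs_mul, Nat.abs_cast] at this
    exact this
  linarith

theorem HQN_bdd (H : Crit G 𝓘) (hab : Finite (Abelianization G)) {N : Subgroup G} [N.Normal]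
    [N.FiniteIndex] {P : G → ℝ} {D : ℝ} (hP : HQN N P D) : ∃ C, ∀ g ∈ N, |P g| ≤ C := by
  classical
  haveI : Finite (G ⧸ N) := Subgroup.finite_quotient_of_finiteIndex
  haveI := Fintype.ofFinite (G ⧸ N)
  let s : G ⧸ N → G := Quotient.out
  have hs : ∀ q : G ⧸ N, (s q : G ⧸ N) = q := fun q => Quotient.out_eq q
  let c : G → G ⧸ N → G := fun g q => (s (g * q))⁻¹ * g * s q
  have hc : ∀ g q, c g q ∈ N := by
    intro g q
    rw [← QuotientGroup.eq_one_iff]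
    simp only [c, QuotientGroup.mk_mul, QuotientGroup.mk_inv, hs]
    group
  have coc : ∀ g h q, c (g * h) q = c g (h * q) * c h q := by
    intro g h q
    simp only [c, QuotientGroup.mk_mul, mul_assoc]
    group
  let φ : G → ℝ := fun g => ∑ q, P (c g q)
  have hφ : ∀ g h, |φ (g * h) - φ g - φ h| ≤ Fintype.card (G ⧸ N) * D := by
    intro g h
    have e : φ g = ∑ q, P (c g (h * q)) :=
      (Equiv.sum_comp (Equiv.mulLeft (h : G ⧸ N)) (fun q => P (c g q))).symm
    rw [e]
    simp only [φ]
    rw [← Finset.sum_sub_distrib, ← Finset.sum_sub_distrib]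
    refine (Finset.abs_sum_le_sum_abs _ _).trans ?_
    refine (Finset.sum_le_card_nsmul _ _ D fun q _ => ?_).trans ?_
    · rw [coc]
      exact hP.defect _ (hc _ _) _ (hc _ _)
    · simp
  obtain ⟨Φ, hΦ, hn⟩ := exists_HQ φ _ hφ
  have hval : ∀ g ∈ N, φ g = Fintype.card (G ⧸ N) * P g := by
    intro g hg
    have : ∀ q, P (c g q) = P g := by
      intro q
      have h1 : (g : G ⧸ N) = 1 := (QuotientGroup.eq_one_iff g).2 hg
      have := H.HQN_conj hP hg (s q)⁻¹
      simp only [c, h1, one_mul]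
      rwa [inv_inv] at this
    simp [φ, this]
  refine ⟨4 * (Fintype.card (G ⧸ N) * D) + Fintype.card (G ⧸ N) * D, fun g hg => ?_⟩
  have h1 := H.HQ_bdd hab hΦ g
  have h2 := hn g
  rw [hval g hg] at h2
  have h3 : (1 : ℝ) ≤ Fintype.card (G ⧸ N) := by exact_mod_cast Fintype.card_pos
  have h4 : |(Fintype.card (G ⧸ N) : ℝ) * P g| ≤
      4 * (Fintype.card (G ⧸ N) * D) + Fintype.card (G ⧸ N) * D := by
    have := abs_sub_abs_le_abs_sub ((Fintype.card (G ⧸ N) : ℝ) * P g) (Φ g)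
    rw [abs_sub_comm] at h2
    linarith
  rw [abs_mul, Nat.abs_cast] at h4
  refine le_trans ?_ h4
  exact le_mul_of_one_le_left (abs_nonneg _) h3

theorem qm_bdd (H : Crit G 𝓘) (hab : Finite (Abelianization G)) (N : Subgroup G) [N.Normal]
    [N.FiniteIndex] (φ : N → ℝ) (D : ℝ) (hφ : ∀ g h, |φ (g * h) - φ g - φ h| ≤ D) :
    ∃ C, ∀ g, |φ g| ≤ C := by
  classical
  obtain ⟨Φ, hΦ, hn⟩ := exists_HQ φ D hφ
  let P : G → ℝ := fun g => if h : g ∈ N then Φ ⟨g, h⟩ else 0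
  have hPv : ∀ n : N, P n = Φ n := fun n => by simp [P]
  have hP : HQN N P (4 * D) := by
    refine ⟨fun g hg h hh e => ?_, fun g hg k hk => ?_, fun g hg h hh => ?_⟩
    · have := hΦ.comm ⟨g, hg⟩ ⟨h, hh⟩ (Subtype.ext e)
      simp only [← hPv] at this
      exact this
    · have := hΦ.conj ⟨g, hg⟩ ⟨k, hk⟩
      simp only [← hPv] at this
      exact this
    · have := hΦ.defect ⟨g, hg⟩ ⟨h, hh⟩
      simp only [← hPv] at this
      exact this
  obtain ⟨C, hC⟩ := H.HQN_bdd hab hP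
  refine ⟨C + D, fun g => ?_⟩
  have h1 := hC g g.2
  rw [hPv] at h1
  have h2 := hn g
  rw [abs_sub_comm] at h2
  have := abs_sub_abs_le_abs_sub (φ g) (Φ g)
  linarith

end Crit
end NLAux
namespace NLAux
open Filter Topology
open scoped Pointwise

/-! ### The main argument -/

section
variable {M : Type*} [MetricSpace M] {δ : ℝ} {Γ : Type*} [Group Γ] [MulAction Γ M]

theorem fixes_transfer (hM : Hyp M δ) (hi : Iso Γ M) {o : M} {f h k : Γ} (hh : SL δ o h)
    (hk : SL δ o k) (hhk : Commute h k) (h1 : Fixes o (fun n => h ^ n • o) f)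
    (h2 : Fixes o (fun n => h⁻¹ ^ n • o) f) : Fixes o (fun n => k ^ n • o) f := by
  rcases lin_fixes hM hi (hk.fixes hM hi hhk) (hh.lin hM hi) with h3 | h3
  · exact h1.congr hM hi h3
  · exact h2.congr hM hi h3

theorem dist_mul_le (hi : Iso Γ M) (o : M) (g h : Γ) :
    dist o ((g * h) • o) ≤ dist o (g • o) + dist o (h • o) := by
  rw [mul_smul]
  refine (dist_triangle o (g • o) _).trans ?_
  rw [hi]

theorem dist_conj_le (hi : Iso Γ M) (o : M) (g k : Γ) :
    dist o ((k * g * k⁻¹) • o) ≤ dist o (g • o) + 2 * dist o (k • o) := by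
  have h1 := dist_mul_le hi o (k * g) k⁻¹
  have h2 := dist_mul_le hi o k g
  rw [dist_smul_inv hi] at h1
  linarith

theorem dist_conj_ge (hi : Iso Γ M) (o : M) (g k : Γ) :
    dist o (g • o) - 2 * dist o (k • o) ≤ dist o ((k * g * k⁻¹) • o) := by
  have h1 := dist_conj_le hi o (k * g * k⁻¹) k⁻¹
  rw [dist_smul_inv hi, show k⁻¹ * (k * g * k⁻¹) * k⁻¹⁻¹ = g by group] at h1
  linarith

theorem not_lin_of_bdd {o : M} {g : Γ} (C : ℝ) (h : ∀ n : ℕ, dist o (g ^ n • o) ≤ C) :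
    ¬ Lin o g := by
  rintro ⟨c, hc, B, hB⟩
  obtain ⟨n, hn⟩ := exists_nat_gt ((C + B) / c)
  rw [div_lt_iff₀ hc] at hn
  have h1 := hB n
  have h2 := h n
  linarith

end

theorem main {G X : Type*} [Group G] [TopologicalSpace X] [MulAction G X] {𝓘 : Set (Set X)}
    (H : Crit G 𝓘) (hab : Finite (Abelianization G)) (N : Subgroup G) [N.Normal]
    [N.FiniteIndex] {M : Type*} [MetricSpace M] [MulAction N M] {δ : ℝ} (hM : Hyp M δ)
    (hi : Iso N M) (o : M) (g : N) : ¬ Lin o g := by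
  have hq := H.qm_bdd hab N
  let A : Set X → Subgroup N := fun J => (Rist G J).comap N.subtype
  have Amono : ∀ J J' : Set X, J ⊆ J' → A J ≤ A J' := fun J J' h =>
    Subgroup.comap_mono (Rist_mono h)
  have Acomm : ∀ {J J' : Set X}, Disjoint J J' → ∀ {f h : N}, f ∈ A J → h ∈ A J' →
      Commute f h := fun d f h hf hh => Subtype.ext (H.commute d hf hh)
  have Aconj : ∀ {J J' : Set X} {f k : N}, f ∈ A J → (k : G) • J = J' →
      k * f * k⁻¹ ∈ A J' := fun hf e => Rist_conj_eq hf e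
  have tr : ∀ J ∈ 𝓘, ∀ J' ∈ 𝓘, ∃ k : N, (k : G) • J = J' := by
    intro J hJ J' hJ'
    obtain ⟨n, hn, e⟩ := H.transN N hJ hJ'
    exact ⟨⟨n, hn⟩, e⟩
  obtain ⟨P1, h1, P2, h2, P3, h3, d12, d13, d23⟩ := H.three
  have gen : ∀ g : N, ∃ a c b : N, (a ∈ A P1ᶜ ∨ a ∈ A P2ᶜ) ∧ c ∈ A P1ᶜ ∧ b ∈ A P3ᶜ ∧
      g = a * c⁻¹ * b * c := by
    intro g
    obtain ⟨a, ha, c, hc, b, hb, q1, q2, q3, e⟩ := H.gen N h1 h2 h3 d12 d13 d23 g g.2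
    exact ⟨⟨a, ha⟩, ⟨c, hc⟩, ⟨b, hb⟩, q1, q2, q3, Subtype.ext e⟩
  have c1 := H.compl _ h1
  have c2 := H.compl _ h2
  have c3 := H.compl _ h3
  by_cases hSL : ∃ I ∈ 𝓘, ∃ g ∈ A I, SL δ o g
  · obtain ⟨I, hI, g₀, hg₀, hsl⟩ := hSL
    have exSL : ∀ J ∈ 𝓘, ∃ h ∈ A J, SL δ o h := by
      intro J hJ
      obtain ⟨k, hk⟩ := tr I hI J hJ
      obtain ⟨m, hm⟩ := ((hsl.lin hM hi).conj hi k).exists_SL (δ := δ)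
      exact ⟨_, Subgroup.pow_mem _ (Aconj hg₀ hk) m, hm⟩
    have fixA : ∀ J ∈ 𝓘, ∀ f ∈ A J, Fixes o (fun n => g₀ ^ n • o) f := by
      intro J hJ f hf
      have cJ := H.compl J hJ
      have cI := H.compl I hI
      obtain ⟨J1, hJ1, K, hK, s1, s2, d⟩ := H.disj (H.isOpen cJ) (H.isOpen cI) (H.nonempty cJ)
        (H.nonempty cI)
      obtain ⟨h, hh, hhs⟩ := exSL J1 hJ1
      obtain ⟨g', hg', hgs⟩ := exSL K hK
      have fh : Commute f h := Acomm (Set.disjoint_right.2 fun x hx => s1 hx) hf hh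
      have hg : Commute h g' := Acomm d hh hg'
      have gg : Commute g' g₀ := Acomm (Set.disjoint_left.2 fun x hx => s2 hx) hg' hg₀
      have f1 := hhs.fixes hM hi fh
      have f2 := (hhs.inv hi).fixes hM hi fh.inv_right
      exact fixes_transfer hM hi hgs hsl gg (fixes_transfer hM hi hhs hgs hg f1 f2)
        (fixes_transfer hM hi hhs (hgs.inv hi) hg.inv_right f1 f2)
    refine not_lin_of_fixes hM hi (p := fun n => g₀ ^ n • o) hq (fun g => ?_) g
    obtain ⟨a, c, b, ha, hc, hb, rfl⟩ := gen g
    have fa : Fixes o (fun n => g₀ ^ n • o) a := by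
      rcases ha with ha | ha
      · exact fixA _ c1 a ha
      · exact fixA _ c2 a ha
    have fc := fixA _ c1 c hc
    have fb := fixA _ c3 b hb
    exact ((fa.mul hM hi (fc.inv hi)).mul hM hi fb).mul hM hi fc
  push Not at hSL
  by_cases hbd : ∃ I ∈ 𝓘, ∃ R : ℝ, ∀ g ∈ A I, dist o (g • o) ≤ R
  · obtain ⟨I, hI, R, hR⟩ := hbd
    have bdA : ∀ J ∈ 𝓘, ∃ R : ℝ, ∀ g ∈ A J, dist o (g • o) ≤ R := by
      intro J hJ
      obtain ⟨k, hk⟩ := tr J hJ I hI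
      refine ⟨R + 2 * dist o (k • o), fun f hf => ?_⟩
      have q1 := hR _ (Aconj hf hk)
      have q2 := dist_conj_ge hi o f k
      linarith
    obtain ⟨R1, hR1⟩ := bdA _ c1
    obtain ⟨R2, hR2⟩ := bdA _ c2
    obtain ⟨R3, hR3⟩ := bdA _ c3
    refine not_lin_of_bdd (max R1 R2 + R1 + R3 + R1) fun n => ?_
    obtain ⟨a, c, b, ha, hc, hb, e⟩ := gen (g ^ n)
    rw [e]
    have q1 := dist_mul_le hi o (a * c⁻¹ * b) c
    have q2 := dist_mul_le hi o (a * c⁻¹) b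
    have q3 := dist_mul_le hi o a c⁻¹
    rw [dist_smul_inv hi] at q3
    have qa : dist o (a • o) ≤ max R1 R2 := by
      rcases ha with ha | ha
      · exact (hR1 a ha).trans (le_max_left _ _)
      · exact (hR2 a ha).trans (le_max_right _ _)
    have qc := hR1 c hc
    have qb := hR3 b hb
    linarith
  push Not at hbd
  have exu : ∀ J : Set X, ∃ u : ℕ → N, J ∈ 𝓘 → (∀ n, u n ∈ A J) ∧
      Tendsto (fun n => dist o (u n • o)) atTop atTop := by
    intro J
    by_cases hJ : J ∈ 𝓘
    · choose u hu hu' using fun n : ℕ => hbd J hJ n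
      exact ⟨u, fun _ => ⟨hu, tendsto_atTop_mono (fun n => (hu' n).le)
        tendsto_natCast_atTop_atTop⟩⟩
    · exact ⟨fun _ => 1, fun h => absurd h hJ⟩
  choose u hu using exu
  have asy : ∀ J ∈ 𝓘, ∀ v w : ℕ → N, (∀ n, v n ∈ A J) → (∀ n, w n ∈ A J) →
      Tendsto (fun n => dist o (v n • o)) atTop atTop →
      Tendsto (fun n => dist o (w n • o)) atTop atTop →
      Asym o (fun n => v n • o) (fun n => w n • o) := fun J hJ v w hv hw hv' hw' =>
    asym_of_not_SL hM hi (A J) (hSL J hJ) hv hw hv' hw'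
  have all : ∀ J ∈ 𝓘, ∀ J' ∈ 𝓘, Asym o (fun n => u J n • o) (fun n => u J' n • o) := by
    intro J hJ J' hJ'
    obtain ⟨U, hU, U', hU', T, hT, s1, s2, -, -, d2, d3⟩ := H.disj3 (H.isOpen hJ)
      (H.isOpen hJ') (H.isOpen h1) (H.nonempty hJ) (H.nonempty hJ') (H.nonempty h1)
    have i1 : U ⊆ Tᶜ := Set.subset_compl_iff_disjoint_right.2 d2
    have i2 : U' ⊆ Tᶜ := Set.subset_compl_iff_disjoint_right.2 d3
    have q1 := asy J hJ (u J) (u U) (hu J hJ).1 (fun n => Amono _ _ s1 ((hu U hU).1 n))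
      (hu J hJ).2 (hu U hU).2
    have q2 := asy Tᶜ (H.compl T hT) (u U) (u U') (fun n => Amono _ _ i1 ((hu U hU).1 n))
      (fun n => Amono _ _ i2 ((hu U' hU').1 n)) (hu U hU).2 (hu U' hU').2
    have q3 := asy J' hJ' (u U') (u J') (fun n => Amono _ _ s2 ((hu U' hU').1 n)) (hu J' hJ').1
      (hu U' hU').2 (hu J' hJ').2
    exact (q1.trans hM q2).trans hM q3
  refine not_lin_of_fixes hM hi (p := fun n => u P1 n • o) hq (fun k => ?_) g
  have hkP : (k : G) • P1 ∈ 𝓘 := H.pres k P1 h1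
  have hv : Tendsto (fun n => dist o ((k * u P1 n * k⁻¹) • o)) atTop atTop := by
    refine tendsto_atTop_mono (fun n => dist_conj_ge hi o (u P1 n) k) ?_
    exact tendsto_atTop_add_const_right _ _ (hu P1 h1).2
  have q1 := all P1 h1 _ hkP
  have q2 := asy _ hkP (u ((k : G) • P1)) (fun n => k * u P1 n * k⁻¹) (hu _ hkP).1
    (fun n => Aconj ((hu P1 h1).1 n) rfl) (hu _ hkP).2 hv
  have q3 := (q1.trans hM q2).near (q' := fun n => k • u P1 n • o) (dist (k⁻¹ • o) o)
    (fun n => by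
      show dist ((k * u P1 n * k⁻¹) • o) (k • u P1 n • o) ≤ _
      rw [mul_smul, mul_smul, hi, hi])
  exact q3.symm

end NLAux

/-- A topological full group acting on a Cantor set with a `G`-invariant basis
of proper clopen sets closed under complements, transitively on `𝓘⁽³⁾` and
`𝓘⁽⁴⁾`, and with finite abelianization, is hereditary (NL). -/
theorem hereditary_NL_of_cantor_criterion {G X : Type*} [Group G]
    [TopologicalSpace X] (hX : IsCantorSet X)
    (a : G → X → X) (hact : IsActionByHomeos G X a)
    (hfaith : FaithfulAction G X a)
    (hfull : IsTopologicalFullGroup G X a)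
    (𝓘 : Set (Set X)) (hbasis : TopologicalSpace.IsTopologicalBasis 𝓘)
    (h𝓘 : ∀ I ∈ 𝓘, I.Nonempty ∧ I ≠ Set.univ ∧ IsClopen I)
    (hcompl : ∀ I ∈ 𝓘, Iᶜ ∈ 𝓘)
    (hpres : ∀ g : G, ∀ I ∈ 𝓘, a g '' I ∈ 𝓘)
    (htrans3 : ∀ I J K I' J' K' : Set X, Tup3 𝓘 I J K → Tup3 𝓘 I' J' K' →
      ∃ g : G, a g '' I = I' ∧ a g '' J = J' ∧ a g '' K = K')
    (htrans4 : ∀ I J K L I' J' K' L' : Set X, Tup4 𝓘 I J K L →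
      Tup4 𝓘 I' J' K' L' → ∃ g : G,
        a g '' I = I' ∧ a g '' J = J' ∧ a g '' K = K' ∧ a g '' L = L')
    (hab : Finite (Abelianization G)) :
    ∀ H : Subgroup G, H.FiniteIndex → PropertyNL H := by
  intro K hK M _ _ hhyp b hb g hlox
  letI : MulAction G X :=
    { smul := a
      one_smul := hact.1
      mul_smul := hact.2.1 }
  have hcl : ∀ I ∈ 𝓘, closure I = I := fun I hI => (h𝓘 I hI).2.2.1.closure_eq
  have htup : ∀ I J K : Set X, (I ∈ 𝓘 ∧ J ∈ 𝓘 ∧ K ∈ 𝓘 ∧ Disjoint I J ∧ Disjoint I K ∧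
      Disjoint J K ∧ (∃ L ∈ 𝓘, Disjoint L (I ∪ J ∪ K))) → Tup3 𝓘 I J K := by
    rintro I J K ⟨hI, hJ, hK, d1, d2, d3, L, hL, dL⟩
    refine ⟨hI, hJ, hK, ?_, ?_, ?_, fun hd => ?_⟩
    · rwa [hcl I hI, hcl J hJ]
    · rwa [hcl I hI, hcl K hK]
    · rwa [hcl J hJ, hcl K hK]
    · obtain ⟨x, hx, hx'⟩ := hd.exists_mem_open (h𝓘 L hL).2.2.2 (h𝓘 L hL).1
      exact Set.disjoint_left.1 dL hx' hx
  obtain ⟨hne, -, hmet, -, hiso⟩ := hX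
  have HC : NLAux.Crit G 𝓘 :=
    { cont := hact.2.2
      t2 := inferInstance
      noiso := hiso
      ne := hne
      faith := hfaith
      full := hfull
      basis := hbasis
      clopen := h𝓘
      compl := hcompl
      pres := hpres
      trans3 := fun I J K I' J' K' h h' =>
        htrans3 I J K I' J' K' (htup _ _ _ h) (htup _ _ _ h') }
  obtain ⟨δ, hδ⟩ := hhyp
  let N : Subgroup G := K.normalCore
  have hNK : N ≤ K := Subgroup.normalCore_le K
  letI : MulAction N M :=
    { smul := fun n x => b ⟨n, hNK n.2⟩ x
      one_smul := hb.1
      mul_smul := fun n n' x => hb.2.1 ⟨n, hNK n.2⟩ ⟨n', hNK n'.2⟩ x }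
  have hi : NLAux.Iso N M := fun n x y => hb.2.2 _ x y
  have hnorm : N.Normal := Subgroup.normalCore_normal K
  have hfin : N.FiniteIndex := inferInstanceAs K.normalCore.FiniteIndex
  obtain ⟨m, hm, -, hmN⟩ := Subgroup.exists_pow_mem_of_index_ne_zero
    (H := N) Subgroup.FiniteIndex.index_ne_zero (g : G)
  obtain ⟨o, A, B, hA, hB, h⟩ := hlox
  refine NLAux.main HC hab N (M := M) hδ hi o ⟨(g : G) ^ m, hmN⟩ ?_
  have hm' : (0 : ℝ) < m := by exact_mod_cast hm
  refine ⟨m / A, by positivity, B, fun n => ?_⟩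
  have h1 := (h ((m * n : ℕ) : ℤ) 0).1
  have e : (⟨(g : G) ^ m, hmN⟩ : N) ^ n • o = b (g ^ (((m * n : ℕ) : ℤ))) o := by
    show b ⟨_, _⟩ o = _
    congr 1
    apply Subtype.ext
    rw [zpow_natCast, pow_mul]
    rfl
  rw [e, dist_comm]
  rw [zpow_zero, hb.1] at h1
  refine le_trans (le_of_eq ?_) h1
  rw [Int.cast_zero, sub_zero, Int.cast_natCast, Nat.abs_cast]
  push_cast
  ring
end

section
/- If a group G admits an isometric action on some Gromov hyperbolic geodesic metric space having a loxodromic element, then G admits a cobounded isometric action on some Gromov hyperbolic geodesic metric space having a loxodromic element. -/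
/-- The action is cobounded: some orbit is coarsely dense. -/
def IsCoboundedAction (G : Type*) [Group G] (X : Type*) [MetricSpace X]
    (a : G → X → X) : Prop :=
  ∃ (x : X) (C : ℝ), 0 ≤ C ∧ ∀ y : X, ∃ g : G, dist y (a g x) ≤ C

/-- A pseudometric given as a bare function. -/
structure PM (X : Type) where
  e : X → X → ℝ
  e0 : ∀ x, e x x = 0
  symm : ∀ x y, e x y = e y x
  tri : ∀ x y z, e x z ≤ e x y + e y z

namespace PM

variable {X : Type} (P : PM X)

/-- Functions dominating the pseudometric. -/
def Dl (f : X → ℝ) : Prop := ∀ x y, P.e x y ≤ f x + f y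

/-- Extremal functions: the points of the tight span. -/
def Ext : Type := {f : X → ℝ // P.Dl f ∧ ∀ x, ∀ ε > 0, ∃ y, f x + f y ≤ P.e x y + ε}

variable {P}

lemma Dl.nonneg {f : X → ℝ} (hf : P.Dl f) (x : X) : 0 ≤ f x := by
  have := hf x x
  rw [P.e0] at this
  linarith

namespace Ext

lemma lip (f : P.Ext) (x y : X) : f.1 x ≤ P.e x y + f.1 y := by
  refine le_of_forall_pos_le_add fun ε hε => ?_
  obtain ⟨w, hw⟩ := f.2.2 x ε hε
  have := P.tri x y w
  have := f.2.1 y w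
  linarith

lemma sub_le (f g : P.Ext) (x x₀ : X) : |f.1 x - g.1 x| ≤ f.1 x₀ + g.1 x₀ := by
  have h1 := f.lip x x₀
  have h2 := g.lip x x₀
  have h3 := f.2.1 x x₀
  have h4 := g.2.1 x x₀
  rw [abs_le]
  constructor <;> linarith

lemma bdd (f g : P.Ext) : BddAbove (Set.range fun x => |f.1 x - g.1 x|) := by
  by_cases h : Nonempty X
  · obtain ⟨x₀⟩ := h
    exact ⟨f.1 x₀ + g.1 x₀, by rintro _ ⟨x, rfl⟩; exact sub_le f g x x₀⟩
  · refine ⟨0, ?_⟩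
    rintro _ ⟨x, rfl⟩
    exact absurd ⟨x⟩ h

/-- The sup distance. -/
noncomputable def d (f g : P.Ext) : ℝ := ⨆ x, |f.1 x - g.1 x|

lemma le_d (f g : P.Ext) (x : X) : |f.1 x - g.1 x| ≤ d f g := le_ciSup (bdd f g) x

lemma d_nonneg (f g : P.Ext) : 0 ≤ d f g := Real.iSup_nonneg fun _ => abs_nonneg _

lemma d_le (f g : P.Ext) {c : ℝ} (hc : 0 ≤ c) (h : ∀ x, |f.1 x - g.1 x| ≤ c) : d f g ≤ c :=
  Real.iSup_le h hc

noncomputable instance : MetricSpace P.Ext where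
  dist := d
  dist_self f := le_antisymm (d_le _ _ le_rfl (by simp)) (d_nonneg _ _)
  dist_comm f g := by
    show d f g = d g f
    unfold d
    simp_rw [abs_sub_comm]
  dist_triangle f g h := by
    refine d_le _ _ (add_nonneg (d_nonneg _ _) (d_nonneg _ _)) fun x => ?_
    exact (abs_sub_le _ (g.1 x) _).trans (add_le_add (le_d _ _ _) (le_d _ _ _))
  eq_of_dist_eq_zero := by
    intro f g h
    refine Subtype.ext (funext fun x => ?_)
    have h1 := le_d f g x
    have h2 : d f g = 0 := h
    rw [h2] at h1
    have := abs_nonpos_iff.1 h1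
    linarith

lemma le_dist (f g : P.Ext) (x : X) : |f.1 x - g.1 x| ≤ dist f g := le_d f g x

lemma dist_le (f g : P.Ext) {c : ℝ} (hc : 0 ≤ c) (h : ∀ x, |f.1 x - g.1 x| ≤ c) :
    dist f g ≤ c := d_le f g hc h

lemma e_le_dist (f g : P.Ext) (x y : X) : P.e x y - f.1 x - g.1 y ≤ dist f g := by
  have h1 := le_dist f g y
  have h2 := f.2.1 x y
  have := (abs_le.1 h1).2
  linarith

lemma approx [Nonempty X] (f g : P.Ext) {ε : ℝ} (hε : 0 < ε) :
    ∃ x y, dist f g ≤ P.e x y - f.1 x - g.1 y + ε := by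
  obtain ⟨x, hx⟩ := exists_lt_of_lt_ciSup (show dist f g - ε / 2 < ⨆ x, |f.1 x - g.1 x| from by
    show d f g - ε / 2 < d f g
    linarith)
  rcases abs_cases (f.1 x - g.1 x) with ⟨h, -⟩ | ⟨h, -⟩ <;> rw [h] at hx
  · obtain ⟨y, hy⟩ := f.2.2 x (ε / 2) (by linarith)
    refine ⟨y, x, ?_⟩
    rw [P.symm y x]
    linarith
  · obtain ⟨y, hy⟩ := g.2.2 x (ε / 2) (by linarith)
    refine ⟨x, y, ?_⟩
    linarith

lemma hyp [Nonempty X] {δ : ℝ} (H : ∀ x y z w, P.e x y + P.e z w ≤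
    max (P.e x z + P.e y w) (P.e x w + P.e y z) + 2 * δ) (f g h k : P.Ext) :
    dist f g + dist h k ≤ max (dist f h + dist g k) (dist f k + dist g h) + 2 * δ := by
  refine le_of_forall_pos_le_add fun ε hε => ?_
  obtain ⟨x, y, h1⟩ := approx f g (half_pos hε)
  obtain ⟨z, w, h2⟩ := approx h k (half_pos hε)
  have h3 := H x y z w
  have a1 := e_le_dist f h x z
  have a2 := e_le_dist g k y w
  have a3 := e_le_dist f k x w
  have a4 := e_le_dist g h y z
  rcases max_cases (P.e x z + P.e y w) (P.e x w + P.e y z) with ⟨m, -⟩ | ⟨m, -⟩ <;> rw [m] at h3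
  · have := le_max_left (dist f h + dist g k) (dist f k + dist g h)
    linarith
  · have := le_max_right (dist f h + dist g k) (dist f k + dist g h)
    linarith

end Ext

/-- The point of the tight span given by a point. -/
def pt (P : PM X) (z : X) : P.Ext := ⟨fun x => P.e x z, fun x y => by
    have := P.tri x z y
    rw [P.symm z y] at this
    exact this, fun x ε hε => ⟨z, by simp only [P.e0]; linarith⟩⟩

lemma e_nonneg (P : PM X) (x y : X) : 0 ≤ P.e x y := by
  have := P.tri x y x
  rw [P.e0, P.symm y x] at this
  linarith

lemma dist_pt (f : P.Ext) (z : X) : dist f (P.pt z) ≤ f.1 z := by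
  refine Ext.dist_le _ _ (f.2.1.nonneg z) fun x => ?_
  have := Ext.sub_le f (P.pt z) x z
  simpa [pt, P.e0] using this

lemma dist_pt_pt (z w : X) : dist (P.pt z) (P.pt w) = P.e z w := by
  apply le_antisymm
  · have := dist_pt (P.pt z) w
    rw [P.symm]
    exact this
  · have := Ext.e_le_dist (P.pt z) (P.pt w) z w
    simpa [pt, P.e0] using this

/-! The Dress retraction. -/

/-- The conjugate function. -/
noncomputable def q (P : PM X) (f : X → ℝ) (x : X) : ℝ := ⨆ y, (P.e x y - f y)

lemma q_bdd {f : X → ℝ} (hf : P.Dl f) (x : X) : BddAbove (Set.range fun y => P.e x y - f y) :=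
  ⟨f x, by rintro _ ⟨y, rfl⟩; have := hf x y; simp only; linarith⟩

lemma le_q {f : X → ℝ} (hf : P.Dl f) (x y : X) : P.e x y - f y ≤ P.q f x :=
  le_ciSup (q_bdd hf x) y

lemma q_le {f : X → ℝ} {x : X} {c : ℝ} (h : ∀ y, P.e x y - f y ≤ c) : P.q f x ≤ c :=
  have : Nonempty X := ⟨x⟩
  ciSup_le h

lemma q_le_self {f : X → ℝ} (hf : P.Dl f) (x : X) : P.q f x ≤ f x :=
  q_le fun y => by have := hf x y; linarith

/-- One averaging step. -/
noncomputable def stp (P : PM X) (f : X → ℝ) (x : X) : ℝ := (f x + P.q f x) / 2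

lemma stp_Dl {f : X → ℝ} (hf : P.Dl f) : P.Dl (P.stp f) := by
  intro x y
  have h1 := le_q hf x y
  have h2 := le_q hf y x
  rw [P.symm y x] at h2
  unfold stp
  linarith

lemma stp_le {f : X → ℝ} (hf : P.Dl f) (x : X) : P.stp f x ≤ f x := by
  have := q_le_self hf x
  unfold stp
  linarith

lemma q_le_q_stp {f : X → ℝ} (hf : P.Dl f) (x : X) : P.q f x ≤ P.q (P.stp f) x :=
  q_le fun y => by
    have := le_q (stp_Dl hf) x y
    have := stp_le hf y
    linarith

lemma it_Dl {f : X → ℝ} (hf : P.Dl f) (n : ℕ) : P.Dl (P.stp^[n] f) := by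
  induction n with
  | zero => exact hf
  | succ n ih => rw [Function.iterate_succ_apply']; exact stp_Dl ih

lemma it_anti {f : X → ℝ} (hf : P.Dl f) (x : X) : Antitone fun n => P.stp^[n] f x := by
  refine antitone_nat_of_succ_le fun n => ?_
  rw [Function.iterate_succ_apply']
  exact stp_le (it_Dl hf n) x

lemma it_gap {f : X → ℝ} (hf : P.Dl f) (x : X) (n : ℕ) :
    P.stp^[n] f x - P.q (P.stp^[n] f) x ≤ (f x - P.q f x) * (1 / 2) ^ n := by
  induction n with
  | zero => simp
  | succ n ih =>
    rw [Function.iterate_succ_apply', pow_succ]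
    have h1 := q_le_q_stp (it_Dl hf n) x
    have h2 : P.stp (P.stp^[n] f) x = (P.stp^[n] f x + P.q (P.stp^[n] f) x) / 2 := rfl
    linarith

/-- The limit of the iteration. -/
noncomputable def ret (P : PM X) (f : X → ℝ) (x : X) : ℝ := ⨅ n : ℕ, P.stp^[n] f x

lemma ret_lim {f : X → ℝ} (hf : P.Dl f) (x : X) :
    Filter.Tendsto (fun n => P.stp^[n] f x) Filter.atTop (nhds (P.ret f x)) :=
  tendsto_atTop_ciInf (it_anti hf x)
    ⟨0, by rintro _ ⟨n, rfl⟩; exact (it_Dl hf n).nonneg x⟩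

lemma ret_le {f : X → ℝ} (hf : P.Dl f) (x : X) (n : ℕ) : P.ret f x ≤ P.stp^[n] f x :=
  ciInf_le (f := fun n => P.stp^[n] f x)
    ⟨0, by rintro _ ⟨n, rfl⟩; exact (it_Dl hf n).nonneg x⟩ n

lemma ret_Dl {f : X → ℝ} (hf : P.Dl f) : P.Dl (P.ret f) := fun x y =>
  ge_of_tendsto' ((ret_lim hf x).add (ret_lim hf y)) fun n => it_Dl hf n x y

/-- The retraction onto the tight span. -/
noncomputable def R (P : PM X) (f : X → ℝ) (hf : P.Dl f) : P.Ext := by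
  refine ⟨P.ret f, ret_Dl hf, fun x ε hε => ?_⟩
  have : Nonempty X := ⟨x⟩
  have hl : Filter.Tendsto (fun n : ℕ => (f x - P.q f x) * (1 / 2) ^ n) Filter.atTop
      (nhds ((f x - P.q f x) * 0)) :=
    (tendsto_pow_atTop_nhds_zero_of_lt_one (by norm_num) (by norm_num)).const_mul _
  rw [mul_zero] at hl
  obtain ⟨n, hn⟩ := (hl.eventually (gt_mem_nhds (half_pos hε))).exists
  have h1 := it_gap hf x n
  have h2 : P.q (P.stp^[n] f) x - ε / 2 < P.q (P.stp^[n] f) x := by linarith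
  obtain ⟨y, hy⟩ := exists_lt_of_lt_ciSup h2
  refine ⟨y, ?_⟩
  have h3 := ret_le hf x n
  have h4 := ret_le hf y n
  linarith

lemma q_ext (f : P.Ext) : P.q f.1 = f.1 := by
  funext x
  refine le_antisymm (q_le_self f.2.1 x) (le_of_forall_pos_le_add fun ε hε => ?_)
  obtain ⟨y, hy⟩ := f.2.2 x ε hε
  have := le_q f.2.1 x y
  linarith

lemma R_ext (f : P.Ext) : P.R f.1 f.2.1 = f := by
  have h : P.stp f.1 = f.1 := by
    funext x
    unfold stp
    rw [q_ext]
    ring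
  apply Subtype.ext
  funext x
  show (⨅ n : ℕ, P.stp^[n] f.1 x) = f.1 x
  have : ∀ n : ℕ, P.stp^[n] f.1 = f.1 := fun n => Function.iterate_fixed h n
  simp_rw [this]
  exact ciInf_const

lemma q_lip {f g : X → ℝ} (hg : P.Dl g) {c : ℝ} (h : ∀ x, g x ≤ f x + c) (x : X) :
    P.q f x ≤ P.q g x + c :=
  q_le fun y => by
    have := le_q hg x y
    have := h y
    linarith

lemma stp_lip {f g : X → ℝ} (hf : P.Dl f) (hg : P.Dl g) {c : ℝ} (h : ∀ x, |f x - g x| ≤ c)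
    (x : X) : |P.stp f x - P.stp g x| ≤ c := by
  have h1 := q_lip hg (fun x => by have := (abs_le.1 (h x)).1; linarith : ∀ x, g x ≤ f x + c) x
  have h2 := q_lip hf (fun x => by have := (abs_le.1 (h x)).2; linarith : ∀ x, f x ≤ g x + c) x
  have h3 := abs_le.1 (h x)
  unfold stp
  rw [abs_le]
  constructor <;> linarith [h3.1, h3.2]

lemma it_lip {f g : X → ℝ} (hf : P.Dl f) (hg : P.Dl g) {c : ℝ} (h : ∀ x, |f x - g x| ≤ c)
    (n : ℕ) : ∀ x : X, |P.stp^[n] f x - P.stp^[n] g x| ≤ c := by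
  induction n with
  | zero => exact h
  | succ n ih =>
    rw [Function.iterate_succ_apply', Function.iterate_succ_apply']
    exact stp_lip (it_Dl hf n) (it_Dl hg n) ih

lemma R_lip {f g : X → ℝ} (hf : P.Dl f) (hg : P.Dl g) {c : ℝ} (hc : 0 ≤ c)
    (h : ∀ x, |f x - g x| ≤ c) : dist (P.R f hf) (P.R g hg) ≤ c :=
  Ext.dist_le _ _ hc fun x =>
    le_of_tendsto' ((ret_lim hf x).sub (ret_lim hg x)).abs fun n => it_lip hf hg h n x

/-- Affine interpolation. -/
def seg (f g : X → ℝ) (r : ℝ) (x : X) : ℝ := f x + r * (g x - f x)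

lemma seg_Dl {f g : X → ℝ} (hf : P.Dl f) (hg : P.Dl g) {r : ℝ} (h0 : 0 ≤ r) (h1 : r ≤ 1) :
    P.Dl (seg f g r) := by
  intro x y
  have a := hf x y
  have b := hg x y
  unfold seg
  nlinarith

lemma geod (P : PM X) : IsGeodesicSpace P.Ext := by
  classical
  intro f g
  rcases eq_or_lt_of_le (dist_nonneg (x := f) (y := g)) with h0 | hpos
  · have : f = g := dist_eq_zero.1 h0.symm
    subst this
    refine ⟨fun _ => f, rfl, rfl, ?_⟩
    rw [dist_self]
    intro s hs t ht
    rw [le_antisymm hs.2 hs.1, le_antisymm ht.2 ht.1]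
    simp
  set L := dist f g with hL
  have hD : ∀ t : Set.Icc (0 : ℝ) L, P.Dl (seg f.1 g.1 (t.1 / L)) := fun t =>
    seg_Dl f.2.1 g.2.1 (div_nonneg t.2.1 hpos.le) ((div_le_one hpos).2 t.2.2)
  let γ : ℝ → P.Ext := fun t =>
    if h : t ∈ Set.Icc (0 : ℝ) L then P.R (seg f.1 g.1 (t / L)) (hD ⟨t, h⟩) else f
  have e0 : γ 0 = f := by
    have h : (0 : ℝ) ∈ Set.Icc (0 : ℝ) L := ⟨le_rfl, hpos.le⟩
    simp only [γ, dif_pos h]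
    have hs : seg f.1 g.1 (0 / L) = f.1 := by funext x; simp [seg]
    simp only [hs]
    exact R_ext f
  have e1 : γ L = g := by
    have h : L ∈ Set.Icc (0 : ℝ) L := ⟨hpos.le, le_rfl⟩
    simp only [γ, dif_pos h]
    have hs : seg f.1 g.1 (L / L) = g.1 := by funext x; simp [seg, div_self hpos.ne']
    simp only [hs]
    exact R_ext g
  have hl : ∀ s ∈ Set.Icc (0 : ℝ) L, ∀ t ∈ Set.Icc (0 : ℝ) L, dist (γ s) (γ t) ≤ |s - t| := by
    intro s hs t ht
    simp only [γ, dif_pos hs, dif_pos ht]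
    refine R_lip _ _ (abs_nonneg _) fun x => ?_
    have hx := Ext.le_dist f g x
    have : seg f.1 g.1 (s / L) x - seg f.1 g.1 (t / L) x = (s - t) * ((g.1 x - f.1 x) / L) := by
      unfold seg; field_simp; ring
    rw [this, abs_mul, abs_div, abs_of_pos hpos, abs_sub_comm (g.1 x)]
    exact mul_le_of_le_one_right (abs_nonneg _) ((div_le_one hpos).2 hx)
  refine ⟨γ, e0, e1, ?_⟩
  have key : ∀ s ∈ Set.Icc (0 : ℝ) L, ∀ t ∈ Set.Icc (0 : ℝ) L, s ≤ t →
      dist (γ s) (γ t) = |s - t| := by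
    intro s hs t ht hst
    refine le_antisymm (hl s hs t ht) ?_
    have h1 := hl 0 ⟨le_rfl, hpos.le⟩ s hs
    have h2 := hl t ht L ⟨hpos.le, le_rfl⟩
    rw [e0] at h1
    rw [e1] at h2
    have h3 := dist_triangle f (γ s) g
    have h4 := dist_triangle (γ s) (γ t) g
    rw [abs_of_nonpos (by linarith [hs.1])] at h1
    rw [abs_of_nonpos (by linarith [ht.2])] at h2
    rw [abs_of_nonpos (by linarith)]
    linarith
  intro s hs t ht
  rcases le_total s t with h | h
  · exact key s hs t ht h
  · rw [dist_comm, abs_sub_comm]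
    exact key t ht s hs h

lemma close (P : PM X) [Nonempty X] {δ c : ℝ} (H : ∀ x y z w, P.e x y + P.e z w ≤
    max (P.e x z + P.e y w) (P.e x w + P.e y z) + 2 * δ)
    (hc : ∀ x y t, 0 ≤ t → t ≤ P.e x y → ∃ z, P.e x z ≤ t + c ∧ P.e z y ≤ P.e x y - t + c)
    (f : P.Ext) : ∃ z, dist f (P.pt z) ≤ c + 2 * δ + 2 := by
  obtain ⟨x⟩ := ‹Nonempty X›
  obtain ⟨y, hy⟩ := f.2.2 x 1 one_pos
  have fx := f.2.1.nonneg x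
  have fy := f.2.1.nonneg y
  obtain ⟨z, h1, h2⟩ := hc x y (min (f.1 x) (P.e x y)) (le_min fx (P.e_nonneg _ _)) (min_le_right _ _)
  refine ⟨z, (dist_pt f z).trans ?_⟩
  have h1' : P.e x z ≤ f.1 x + c := by linarith [min_le_left (f.1 x) (P.e x y)]
  have h2' : P.e z y ≤ f.1 y + c := by
    have := f.2.1 x y
    rcases min_cases (f.1 x) (P.e x y) with ⟨m, -⟩ | ⟨m, -⟩ <;> rw [m] at h2 <;> linarith
  obtain ⟨w, hw⟩ := f.2.2 z 1 one_pos
  have h3 := H z w x y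
  have h4 := f.2.1 w y
  have h5 := f.2.1 w x
  rw [P.symm z x] at h3
  rcases max_cases (P.e x z + P.e w y) (P.e z y + P.e w x) with ⟨m, -⟩ | ⟨m, -⟩ <;>
    rw [m] at h3 <;> linarith

/-- Action on the tight span. -/
def act {G : Type*} [Group G] (P : PM X) (a : G → X → X)
    (hi : ∀ g x y, P.e (a g x) (a g y) = P.e x y)
    (h1 : ∀ x, a 1 x = x) (hm : ∀ g h x, a (g * h) x = a g (a h x)) (g : G) (f : P.Ext) : P.Ext :=
  ⟨fun x => f.1 (a g⁻¹ x), fun x y => by rw [← hi g⁻¹]; exact f.2.1 _ _, fun x ε hε => by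
    obtain ⟨y, hy⟩ := f.2.2 (a g⁻¹ x) ε hε
    refine ⟨a g y, ?_⟩
    have : a g⁻¹ (a g y) = y := by rw [← hm, inv_mul_cancel, h1]
    rw [← hi g⁻¹ x, this]
    simp only [this]
    exact hy⟩

theorem main {G : Type*} [Group G] (P : PM X) (a : G → X → X)
    (hi : ∀ g x y, P.e (a g x) (a g y) = P.e x y)
    (h1 : ∀ x, a 1 x = x) (hm : ∀ g h x, a (g * h) x = a g (a h x))
    {δ c : ℝ} (hδ : 0 ≤ δ) (H : ∀ x y z w, P.e x y + P.e z w ≤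
    max (P.e x z + P.e y w) (P.e x w + P.e y z) + 2 * δ)
    (hc : ∀ x y t, 0 ≤ t → t ≤ P.e x y → ∃ z, P.e x z ≤ t + c ∧ P.e z y ≤ P.e x y - t + c)
    (x₀ : X) {C : ℝ} (hC : ∀ x, ∃ g, P.e x (a g x₀) ≤ C)
    (g : G) {A B : ℝ} (hA : 1 ≤ A) (hB : 0 ≤ B) (hlox : ∀ m n : ℤ,
    |(m : ℝ) - (n : ℝ)| / A - B ≤ P.e (a (g ^ m) x₀) (a (g ^ n) x₀) ∧
      P.e (a (g ^ m) x₀) (a (g ^ n) x₀) ≤ A * |(m : ℝ) - (n : ℝ)| + B) :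
    ∃ (Y : Type) (m : MetricSpace Y) (a : G → Y → Y),
      @IsGeodesicSpace Y m ∧ @IsGromovHyperbolic Y m ∧
        @IsIsometricAction G _ Y m a ∧ @IsCoboundedAction G _ Y m a ∧
        ∃ g : G, @IsLoxodromic G _ Y m a g := by
  have : Nonempty X := ⟨x₀⟩
  have hinv : ∀ (g : G) x, a g⁻¹ (a g x) = x := fun g x => by rw [← hm, inv_mul_cancel, h1]
  have hinv' : ∀ (g : G) x, a g (a g⁻¹ x) = x := fun g x => by rw [← hm, mul_inv_cancel, h1]
  have hpt : ∀ g x, P.act a hi h1 hm g (P.pt x) = P.pt (a g x) := by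
    intro g x
    apply Subtype.ext
    funext y
    show P.e (a g⁻¹ y) x = P.e y (a g x)
    rw [← hi g, hinv']
  refine ⟨P.Ext, inferInstance, P.act a hi h1 hm, P.geod, ⟨δ, hδ, Ext.hyp H⟩, ⟨?_, ?_, ?_⟩, ?_, g, ?_⟩
  · intro f
    apply Subtype.ext
    funext y
    simp [act, h1]
  · intro g h f
    apply Subtype.ext
    funext y
    simp [act, hm]
  · have : ∀ g f f', dist (P.act a hi h1 hm g f) (P.act a hi h1 hm g f') ≤ dist f f' := by
      intro g f f'
      exact Ext.dist_le _ _ dist_nonneg fun x => Ext.le_dist f f' _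
    intro g f f'
    refine le_antisymm (this g f f') ?_
    refine Ext.dist_le _ _ dist_nonneg fun x => ?_
    have := Ext.le_dist (P.act a hi h1 hm g f) (P.act a hi h1 hm g f') (a g x)
    simpa [act, hinv] using this
  · refine ⟨P.pt x₀, max (c + 2 * δ + 2 + C) 0, le_max_right _ _, fun f => ?_⟩
    obtain ⟨z, hz⟩ := P.close H hc f
    obtain ⟨g, hg⟩ := hC z
    refine ⟨g, ?_⟩
    rw [hpt]
    have := dist_triangle f (P.pt z) (P.pt (a g x₀))
    rw [dist_pt_pt] at this
    exact le_max_of_le_left (by linarith)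
  · refine ⟨P.pt x₀, A, B, hA, hB, fun m n => ?_⟩
    rw [hpt, hpt, dist_pt_pt]
    exact hlox m n

end PM
namespace Hyp

/-- Four point condition with constant `δ`. -/
def FP (X : Type) [MetricSpace X] (δ : ℝ) : Prop := ∀ x y z w : X,
    dist x y + dist z w ≤ max (dist x z + dist y w) (dist x w + dist y z) + 2 * δ

/-- `γ` is a geodesic from `x` to `y`. -/
def Geo {X : Type} [MetricSpace X] (γ : ℝ → X) (x y : X) : Prop :=
  γ 0 = x ∧ γ (dist x y) = y ∧
    ∀ s ∈ Set.Icc (0 : ℝ) (dist x y), ∀ t ∈ Set.Icc (0 : ℝ) (dist x y),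
      dist (γ s) (γ t) = |s - t|

variable {X : Type} [MetricSpace X]

/-- Gromov product based at `p`. -/
noncomputable def gp (p x y : X) : ℝ := (dist p x + dist p y - dist x y) / 2

lemma gp_comm (p x y : X) : gp p x y = gp p y x := by
  unfold gp
  rw [dist_comm x y]
  ring

lemma gp_self (p x : X) : gp p x x = dist p x := by
  unfold gp
  rw [dist_self]
  ring

lemma gp_hyp {δ : ℝ} (H : FP X δ) (p x y z : X) :
    min (gp p x y) (gp p y z) ≤ gp p x z + δ := by
  have h := H x z y p
  unfold gp
  rw [dist_comm y p, dist_comm x p, dist_comm z p, dist_comm z y] at h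
  rcases max_cases (dist x y + dist p z) (dist p x + dist y z) with ⟨m, -⟩ | ⟨m, -⟩ <;> rw [m] at h
  · exact (min_le_left _ _).trans (by linarith)
  · exact (min_le_right _ _).trans (by linarith)

lemma Geo.d0 {γ : ℝ → X} {x y : X} (h : Geo γ x y) {t : ℝ} (ht : t ∈ Set.Icc 0 (dist x y)) :
    dist x (γ t) = t := by
  have := h.2.2 0 ⟨le_rfl, dist_nonneg⟩ t ht
  rw [h.1, zero_sub, abs_neg, abs_of_nonneg ht.1] at this
  exact this

lemma Geo.d1 {γ : ℝ → X} {x y : X} (h : Geo γ x y) {t : ℝ} (ht : t ∈ Set.Icc 0 (dist x y)) :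
    dist (γ t) y = dist x y - t := by
  have := h.2.2 t ht _ ⟨dist_nonneg, le_rfl⟩
  rw [h.2.1, abs_sub_comm, abs_of_nonneg (by linarith [ht.2])] at this
  exact this

lemma Geo.sub {γ : ℝ → X} {x y : X} (h : Geo γ x y) {s t : ℝ} (hs : 0 ≤ s) (hst : s ≤ t)
    (ht : t ≤ dist x y) : Geo (fun r => γ (s + r)) (γ s) (γ t) := by
  have hd : dist (γ s) (γ t) = t - s := by
    rw [h.2.2 s ⟨hs, by linarith⟩ t ⟨by linarith, ht⟩, abs_sub_comm, abs_of_nonneg (by linarith)]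
  refine ⟨by simp, by simp [hd], ?_⟩
  rw [hd]
  intro a ha b hb
  rw [h.2.2 _ ⟨by linarith [ha.1], by linarith [ha.2]⟩ _ ⟨by linarith [hb.1], by linarith [hb.2]⟩]
  congr 1
  ring

lemma Geo.rev {γ : ℝ → X} {x y : X} (h : Geo γ x y) : Geo (fun r => γ (dist x y - r)) y x := by
  refine ⟨by simp [h.2.1], by simp [dist_comm y x, h.1], ?_⟩
  rw [dist_comm y x]
  intro a ha b hb
  rw [h.2.2 _ ⟨by linarith [ha.2], by linarith [ha.1]⟩ _ ⟨by linarith [hb.2], by linarith [hb.1]⟩,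
    abs_sub_comm]
  congr 1
  ring

lemma near {δ : ℝ} (H : FP X δ) {γ : ℝ → X} {x y : X} (h : Geo γ x y) (p : X) :
    ∃ t ∈ Set.Icc 0 (dist x y), dist p (γ t) ≤ gp p x y + 2 * δ := by
  have a1 := dist_triangle x p y
  have a2 := dist_triangle p x y
  have a3 := dist_triangle x y p
  rw [dist_comm p x] at a2
  rw [dist_comm y p] at a3
  have ht : (dist x p + dist x y - dist p y) / 2 ∈ Set.Icc 0 (dist x y) :=
    ⟨by linarith, by linarith⟩
  refine ⟨_, ht, ?_⟩
  have b0 := h.d0 ht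
  have b1 := h.d1 ht
  have h4 := H x y p (γ ((dist x p + dist x y - dist p y) / 2))
  rw [dist_comm y (γ _), b0, b1, dist_comm y p] at h4
  unfold gp
  rw [dist_comm p x]
  rcases max_cases (dist x p + (dist x y - (dist x p + dist x y - dist p y) / 2))
    ((dist x p + dist x y - dist p y) / 2 + dist p y) with ⟨m, -⟩ | ⟨m, -⟩ <;> rw [m] at h4 <;>
    linarith

lemma meet {δ : ℝ} (hδ : 0 ≤ δ) (H : FP X δ) {γ : ℝ → X} {x z : X} (h : Geo γ x z) (y w : X)
    (hy : dist x y + dist z w ≤ dist x z + dist y w + 2 * δ) :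
    ∃ t ∈ Set.Icc 0 (dist x z), gp (γ t) y w ≤ 5 * δ := by
  have hw : dist x w + dist y z ≤ dist x z + dist y w + 4 * δ := by
    have := H x w y z
    rw [dist_comm w z, dist_comm w y] at this
    rcases max_cases (dist x y + dist z w) (dist x z + dist y w) with ⟨m, -⟩ | ⟨m, -⟩ <;>
      rw [dist_comm] at m <;> rw [dist_comm y x] at m <;> rw [m] at this <;> linarith
  have a1 := dist_triangle y x w
  rw [dist_comm y x] at a1
  have a2 := dist_triangle y z w
  set t := min ((dist x y + dist x w - dist y w) / 2) (dist x z) with ht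
  have t1 : t ≤ dist x z := min_le_right _ _
  have t2 : t ≤ (dist x y + dist x w - dist y w) / 2 := min_le_left _ _
  have t0 : 0 ≤ t := le_min (by linarith) dist_nonneg
  have t3 : (dist x y + dist x w - dist y w) / 2 - 3 * δ ≤ t :=
    le_min (by linarith) (by linarith)
  have t4 : (dist y z + dist z w - dist y w) / 2 - 3 * δ ≤ dist x z - t := by linarith
  refine ⟨t, ⟨t0, t1⟩, ?_⟩
  have b0 := h.d0 ⟨t0, t1⟩
  have b1 := h.d1 ⟨t0, t1⟩
  have c1 := H x z y (γ t)
  have c2 := H x z w (γ t)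
  rw [dist_comm z (γ t), b0, b1, dist_comm y (γ t), dist_comm z y] at c1
  rw [dist_comm z (γ t), b0, b1, dist_comm w (γ t)] at c2
  unfold gp
  rcases max_cases (dist x y + (dist x z - t)) (t + dist y z) with ⟨m, -⟩ | ⟨m, -⟩ <;>
    rw [m] at c1 <;>
  rcases max_cases (dist x w + (dist x z - t)) (t + dist z w) with ⟨m, -⟩ | ⟨m, -⟩ <;>
    rw [m] at c2 <;> linarith

/-- Edge condition. -/
def Ed (e : X → X → ℝ) (C : ℝ) (u v : X) : Prop := ∀ p, e p u ≤ gp p u v + C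

lemma piece {δ : ℝ} (hδ : 0 ≤ δ) (H : FP X δ) {e : X → X → ℝ} {C : ℝ}
    (he : ∀ x y, e x y ≤ dist x y + C) (p : X) (m : ℝ) (k : ℕ) :
    ∀ (N : ℕ) (u : ℕ → X), N ≤ 2 ^ k → (∀ i < N, Ed e C (u i) (u (i + 1))) →
      (∀ i ≤ N, m ≤ e p (u i)) → m ≤ gp p (u 0) (u N) + k * δ + C := by
  induction k with
  | zero =>
    intro N u hN hu hm
    have h0 := hm 0 (Nat.zero_le _)
    simp only [pow_zero] at hN
    interval_cases N
    · have := he p (u 0)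
      rw [gp_self]
      simp
      linarith
    · have := hu 0 one_pos p
      simp at this ⊢
      linarith
  | succ k ih =>
    intro N u hN hu hm
    rw [pow_succ] at hN
    have A := ih (N / 2) u (by omega) (fun i hi => hu i (by omega)) (fun i hi => hm i (by omega))
    have B := ih (N - N / 2) (fun i => u (N / 2 + i)) (by omega)
      (fun i hi => hu (N / 2 + i) (by omega)) (fun i hi => hm _ (by omega))
    have e1 : N / 2 + (N - N / 2) = N := by omega
    simp only [add_zero, e1] at B
    have := gp_hyp H p (u 0) (u (N / 2)) (u N)
    push_cast
    rcases min_cases (gp p (u 0) (u (N / 2))) (gp p (u (N / 2)) (u N)) with ⟨m, -⟩ | ⟨m, -⟩ <;>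
      rw [m] at this <;> linarith

/-- Any two points are joined by short chains. -/
def Chn (e : X → X → ℝ) (C : ℝ) : Prop := ∀ x y, ∃ (N : ℕ) (u : ℕ → X), u 0 = x ∧ u N = y ∧
  (N : ℝ) ≤ e x y + 1 ∧ (∀ i < N, Ed e C (u i) (u (i + 1))) ∧ ∀ i ≤ N, e x (u i) ≤ e x y + 1

lemma side {δ : ℝ} (hδ : 0 ≤ δ) (H : FP X δ) (P : PM X) {C : ℝ} (hC : 0 ≤ C)
    (he : ∀ x y, P.e x y ≤ dist x y + C) (hch : Chn P.e C) (n : ℕ) (u : ℕ → X)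
    (M : ℝ) (hM : 0 ≤ M) (η : ℝ → X) (L : ℝ) (hL : 0 ≤ L)
    (hη : ∀ s ∈ Set.Icc 0 L, ∀ t ∈ Set.Icc 0 L, dist (η s) (η t) = |s - t|)
    (hn : ∀ s ∈ Set.Icc 0 L, ∃ i ≤ n, P.e (η s) (u i) ≤ M)
    (i₀ : ℕ) (hi₀ : i₀ ≤ n) (hend : η L = u i₀) (hp : ∀ i ≤ n, M - 1 ≤ P.e (η 0) (u i))
    (k : ℕ) (hk : M + 1 ≤ 2 ^ k) :
    ∃ s ∈ Set.Icc 0 L, ∃ i ≤ n, P.e (η 0) (η s) ≤ 2 * M + 3 + C ∧ P.e (η s) (u i) ≤ M ∧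
      M - 1 ≤ gp (η 0) (η s) (u i) + k * δ + C := by
  by_cases hc : ∃ s ∈ Set.Icc 0 L, 2 * M + 2 ≤ P.e (η 0) (η s) ∧ P.e (η 0) (η s) ≤ 2 * M + 3 + C
  · obtain ⟨s, hs, h1, h2⟩ := hc
    obtain ⟨i, hi, hM'⟩ := hn s hs
    refine ⟨s, hs, i, hi, h2, hM', ?_⟩
    obtain ⟨N, w, w0, wN, hN, hw, hw'⟩ := hch (η s) (u i)
    have := piece hδ H he (η 0) (M - 1) k N w (by
      have : (N : ℝ) ≤ 2 ^ k := by linarith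
      exact_mod_cast this) hw (fun j hj => by
        have a1 := hw' j hj
        have a2 := P.tri (η 0) (w j) (η s)
        rw [P.symm (w j)] at a2
        linarith)
    rw [w0, wN] at this
    exact this
  · push Not at hc
    have key : ∀ k : ℕ, ∀ s ∈ Set.Icc 0 L, s ≤ k → P.e (η 0) (η s) < 2 * M + 2 := by
      intro k
      induction k with
      | zero =>
        intro s hs h
        have : s = 0 := le_antisymm (by simpa using h) hs.1
        rw [this, P.e0]
        linarith
      | succ k ih =>
        intro s hs h
        push_cast at h
        have hs' : max (s - 1) 0 ∈ Set.Icc 0 L := ⟨le_max_right _ _, max_le (by linarith [hs.2]) hL⟩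
        have h1 := ih _ hs' (max_le (by linarith) (Nat.cast_nonneg k))
        by_contra hcon
        push Not at hcon
        have h2 := hc s hs hcon
        have h3 := P.tri (η 0) (η (max (s - 1) 0)) (η s)
        have h4 := he (η (max (s - 1) 0)) (η s)
        rw [hη _ hs' _ hs] at h4
        have : |max (s - 1) 0 - s| ≤ 1 := by
          rw [abs_le]
          constructor
          · linarith [le_max_left (s - 1) 0]
          · linarith [max_le (by linarith : s - 1 ≤ s) hs.1]
        linarith
    obtain ⟨k', hk'⟩ := exists_nat_ge L
    have h1 := key k' L ⟨hL, le_rfl⟩ hk'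
    refine ⟨L, ⟨hL, le_rfl⟩, i₀, hi₀, by linarith, ?_, ?_⟩
    · rw [hend, P.e0]
      exact hM
    · rw [hend, gp_self]
      have := hp i₀ hi₀
      have := he (η 0) (u i₀)
      have : 0 ≤ k * δ := by positivity
      linarith

lemma growth (δ C α β : ℝ) (hδ : 0 ≤ δ) : ∃ M₀ : ℕ, ∀ M : ℕ, M₀ ≤ M →
    ∃ k : ℕ, α * M + β ≤ 2 ^ k ∧ k * δ + C < M := by
  obtain ⟨q, hq⟩ := exists_nat_ge (2 * δ + 2)
  have hq0 : 0 < (q : ℝ) := by linarith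
  have hq1 : 0 < q := by exact_mod_cast hq0
  set c : ℝ := |α| * q + |β| with hc
  have hc0 : 0 ≤ c := by positivity
  have h1 := tendsto_pow_const_div_const_pow_of_one_lt 1 (one_lt_two (α := ℝ))
  have h2 := h1.eventually (gt_mem_nhds (show (0 : ℝ) < 1 / (2 * c + 1) by positivity))
  obtain ⟨k₀, hk₀⟩ := Filter.eventually_atTop.1 h2
  obtain ⟨m, hm⟩ := exists_nat_gt (2 * |C|)
  refine ⟨q * (k₀ + 1) + m, fun M hM => ⟨M / q, ?_, ?_⟩⟩
  · have hk : k₀ + 1 ≤ M / q := by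
      rw [Nat.le_div_iff_mul_le hq1]
      nlinarith
    have h3 := hk₀ (M / q) (by omega)
    have h4 : M < q * (M / q + 1) := by
      have := Nat.lt_div_mul_add (a := M) hq1
      nlinarith
    have h5 : (M : ℝ) ≤ q * (((M / q : ℕ) : ℝ) + 1) := by exact_mod_cast h4.le
    have h6 : (1 : ℝ) ≤ ((M / q : ℕ) : ℝ) := by
      have : 1 ≤ M / q := by omega
      exact_mod_cast this
    set k := M / q
    have hp : (0 : ℝ) < 2 ^ k := by positivity
    rw [pow_one, div_lt_div_iff₀ hp (by positivity)] at h3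
    have h7 : α * M ≤ |α| * (q * ((k : ℝ) + 1)) :=
      (mul_le_mul_of_nonneg_right (le_abs_self α) (Nat.cast_nonneg _)).trans
        (mul_le_mul_of_nonneg_left h5 (abs_nonneg _))
    have h8 : β ≤ |β| * ((k : ℝ) + 1) := by
      have := le_abs_self β
      nlinarith [abs_nonneg β]
    have h9 : α * M + β ≤ c * (k + 1) := by
      rw [hc]
      linarith
    nlinarith
  · have h1 : ((M / q : ℕ) : ℝ) * q ≤ M := by exact_mod_cast Nat.div_mul_le_self M q
    have h2 : ((M / q : ℕ) : ℝ) * δ * 2 ≤ M := by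
      have : (0 : ℝ) ≤ ((M / q : ℕ) : ℝ) := Nat.cast_nonneg _
      nlinarith
    have h3 : (m : ℝ) ≤ M := by
      have : m ≤ M := by omega
      exact_mod_cast this
    linarith [le_abs_self C]

lemma stab {δ : ℝ} (hδ : 0 ≤ δ) (H : FP X δ) (hX : IsGeodesicSpace X) (P : PM X) {C : ℝ}
    (hC : 0 ≤ C)
    (he : ∀ x y, P.e x y ≤ dist x y + C) (hch : Chn P.e C) (A B : ℝ) (hA : 0 ≤ A) (hB : 0 ≤ B) :
    ∃ M : ℝ, ∀ (n : ℕ) (u : ℕ → X), (∀ i < n, Ed P.e C (u i) (u (i + 1))) →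
      (∀ i j, i ≤ j → j ≤ n → (j : ℝ) - i ≤ A * P.e (u i) (u j) + B) →
      ∀ p, ∃ i ≤ n, P.e p (u i) ≤ gp p (u 0) (u n) + M := by
  obtain ⟨M₀, hM₀⟩ := growth δ (2 * δ + C + 1) (1 + 6 * A) (1 + A * (6 + 2 * C) + B) hδ
  refine ⟨M₀ + 2 * δ + C, fun n u hu hq => ?_⟩
  obtain ⟨γ, hγ⟩ := hX (u 0) (u n)
  change Geo γ (u 0) (u n) at hγ
  suffices hs : ∀ t ∈ Set.Icc 0 (dist (u 0) (u n)), ∃ i ≤ n, P.e (γ t) (u i) ≤ M₀ by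
    intro p
    obtain ⟨t, ht, hd⟩ := near H hγ p
    obtain ⟨i, hi, h⟩ := hs t ht
    refine ⟨i, hi, ?_⟩
    have := P.tri p (γ t) (u i)
    have := he p (γ t)
    linarith
  set l := dist (u 0) (u n) with hl
  have hl0 : 0 ≤ l := dist_nonneg
  have hex : ∃ M : ℕ, ∀ t ∈ Set.Icc 0 l, ∃ i ≤ n, P.e (γ t) (u i) ≤ M := by
    obtain ⟨M, hM⟩ := exists_nat_ge (l + C)
    refine ⟨M, fun t ht => ⟨0, Nat.zero_le _, ?_⟩⟩
    have h1 := he (γ t) (u 0)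
    rw [dist_comm, hγ.d0 ht] at h1
    linarith [ht.2]
  classical
  set M := Nat.find hex with hMdef
  have hM := Nat.find_spec hex
  rw [← hMdef] at hM
  by_cases hle : M ≤ M₀
  · intro t ht
    obtain ⟨i, hi, h⟩ := hM t ht
    exact ⟨i, hi, h.trans (by exact_mod_cast hle)⟩
  exfalso
  push Not at hle
  have hlt := Nat.find_min hex (m := M - 1) (by omega)
  push Not at hlt
  obtain ⟨t, ht, hfar⟩ := hlt
  have hM1 : ((M - 1 : ℕ) : ℝ) = M - 1 := by
    rw [Nat.cast_sub (by omega)]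
    simp
  rw [hM1] at hfar
  obtain ⟨k, hk1, hk2⟩ := hM₀ M hle.le
  have hMn : (0 : ℝ) ≤ M := Nat.cast_nonneg _
  have hAM : 0 ≤ A * M := by positivity
  have hAC : 0 ≤ A * (6 + 2 * C) := by positivity
  have hk3 : (M : ℝ) + 1 ≤ 2 ^ k := by nlinarith
  obtain ⟨s, hs, i, hi, a1, a2, a3⟩ := side hδ H P hC he hch n u M hMn (fun r => γ (t - r)) t ht.1
    (fun a ha b hb => by
      rw [hγ.2.2 _ ⟨by linarith [ha.2], by linarith [ha.1, ht.2]⟩ _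
        ⟨by linarith [hb.2], by linarith [hb.1, ht.2]⟩, abs_sub_comm]
      congr 1
      ring)
    (fun a ha => hM _ ⟨by linarith [ha.2], by linarith [ha.1, ht.2]⟩)
    0 (Nat.zero_le _) (by simp [hγ.1]) (fun i hi => by simpa using (hfar i hi).le) k hk3
  obtain ⟨s', hs', j, hj, b1, b2, b3⟩ := side hδ H P hC he hch n u M hMn (fun r => γ (t + r))
    (l - t) (by linarith [ht.2])
    (fun a ha b hb => by
      rw [hγ.2.2 _ ⟨by linarith [ha.1, ht.1], by linarith [ha.2]⟩ _
        ⟨by linarith [hb.1, ht.1], by linarith [hb.2]⟩]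
      congr 1
      ring)
    (fun a ha => hM _ ⟨by linarith [ha.1, ht.1], by linarith [ha.2]⟩)
    n le_rfl (by simp [hl, hγ.2.1]) (fun i hi => by simpa using (hfar i hi).le) k hk3
  simp only [sub_zero, add_zero] at a1 a2 a3 b1 b2 b3
  have hab : gp (γ t) (γ (t - s)) (γ (t + s')) = 0 := by
    unfold gp
    have m1 : t - s ∈ Set.Icc 0 l := ⟨by linarith [hs.2], by linarith [hs.1, ht.2]⟩
    have m2 : t + s' ∈ Set.Icc 0 l := ⟨by linarith [hs'.1, ht.1], by linarith [hs'.2]⟩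
    rw [hγ.2.2 _ ht _ m1, hγ.2.2 _ ht _ m2, hγ.2.2 _ m1 _ m2]
    rw [abs_of_nonneg (by linarith [hs.1]), abs_of_nonpos (by linarith [hs'.1]),
      abs_of_nonpos (by linarith [hs.1, hs'.1])]
    ring
  have hij : P.e (u i) (u j) ≤ 6 * M + 6 + 2 * C := by
    have c1 := P.tri (u i) (γ (t - s)) (u j)
    have c2 := P.tri (γ (t - s)) (γ t) (u j)
    have c3 := P.tri (γ t) (γ (t + s')) (u j)
    rw [P.symm (u i) (γ (t - s))] at c1
    rw [P.symm _ (γ t)] at c2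
    linarith
  have mid : ∀ i j, i ≤ j → j ≤ n → P.e (u i) (u j) ≤ 6 * M + 6 + 2 * C →
      (M : ℝ) - 1 ≤ gp (γ t) (u i) (u j) + k * δ + C := by
    intro i j hij hj hle
    have := piece hδ H he (γ t) ((M : ℝ) - 1) k (j - i) (fun r => u (i + r)) (by
      have h1 := hq i j hij hj
      have h2 : A * P.e (u i) (u j) ≤ A * (6 * M + 6 + 2 * C) := mul_le_mul_of_nonneg_left hle hA
      have : ((j - i : ℕ) : ℝ) ≤ 2 ^ k := by
        rw [Nat.cast_sub hij]
        nlinarith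
      exact_mod_cast this) (fun r hr => hu _ (by omega)) (fun r hr => (hfar _ (by omega)).le)
    simp only [add_zero, Nat.add_sub_cancel' hij] at this
    exact this
  have mid' : (M : ℝ) - 1 ≤ gp (γ t) (u i) (u j) + k * δ + C := by
    rcases le_total i j with h | h
    · exact mid i j h hj hij
    · rw [gp_comm]
      exact mid j i h hi (by rw [P.symm]; exact hij)
  have g1 := gp_hyp H (γ t) (γ (t - s)) (u i) (γ (t + s'))
  have g2 := gp_hyp H (γ t) (u i) (u j) (γ (t + s'))
  rw [gp_comm _ (γ (t + s'))] at b3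
  have g3 : (M : ℝ) - 1 - k * δ - C ≤ gp (γ t) (u i) (γ (t + s')) + δ :=
    le_trans (le_min (by linarith) (by linarith)) g2
  have g4 : (M : ℝ) - 1 - k * δ - C - δ ≤ gp (γ t) (γ (t - s)) (γ (t + s')) + δ :=
    le_trans (le_min (by linarith) (by linarith)) g1
  linarith

/-- The pseudometric underlying the metric. -/
noncomputable def dPM (X : Type) [MetricSpace X] : PM X where
  e := dist
  e0 := dist_self
  symm := dist_comm
  tri := dist_triangle

lemma Ed_of_le {C : ℝ} {u v : X} (h : dist u v ≤ C) : Ed (dPM X).e C u v := by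
  intro p
  show dist p u ≤ gp p u v + C
  have h1 := dist_triangle p v u
  rw [dist_comm v u] at h1
  unfold gp
  linarith

lemma chn_dist (hX : IsGeodesicSpace X) {C : ℝ} (hC : 1 ≤ C) : Chn (dPM X).e C := by
  intro x y
  obtain ⟨γ, hγ⟩ := hX x y
  change Geo γ x y at hγ
  have hm : ∀ i : ℕ, min (i : ℝ) (dist x y) ∈ Set.Icc 0 (dist x y) := fun i =>
    ⟨le_min (Nat.cast_nonneg _) dist_nonneg, min_le_right _ _⟩
  refine ⟨⌈dist x y⌉₊, fun i => γ (min (i : ℝ) (dist x y)), ?_, ?_, ?_, ?_, ?_⟩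
  · simp [hγ.1]
  · simp only [min_eq_right (Nat.le_ceil (dist x y))]
    exact hγ.2.1
  · exact (Nat.ceil_lt_add_one dist_nonneg).le
  · intro i _
    apply Ed_of_le
    rw [hγ.2.2 _ (hm i) _ (hm (i + 1))]
    refine (abs_min_sub_min_le_max _ _ _ _).trans ?_
    simpa using hC
  · intro i _
    show dist x (γ _) ≤ dist x y + 1
    rw [hγ.d0 (hm i)]
    linarith [(hm i).2]

/-- Projection coordinate. -/
noncomputable def ph (a b p : X) : ℝ := (dist p a - dist p b) / 2

lemma ph_lip (a b p q : X) : ph a b p - ph a b q ≤ dist p q := by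
  unfold ph
  have h1 := dist_triangle p q a
  have h2 := dist_triangle q p b
  rw [dist_comm q p] at h2
  linarith

variable (mk : X → X → Prop) (D : ℝ)

/-- Small pairs. -/
def Sm (u v : X) : Prop := ∃ γ, Geo γ u v ∧ ∀ s ∈ Set.Icc 0 (dist u v), ∀ t ∈ Set.Icc 0 (dist u v),
  ∀ a b, mk a b → ph a b (γ s) - ph a b (γ t) ≤ D

variable {mk D}

lemma Sm.symm {u v : X} (h : Sm mk D u v) : Sm mk D v u := by
  obtain ⟨γ, hγ, h⟩ := h
  refine ⟨_, hγ.rev, ?_⟩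
  rw [dist_comm v u]
  intro s hs t ht a b hab
  exact h _ ⟨by linarith [hs.2], by linarith [hs.1]⟩ _ ⟨by linarith [ht.2], by linarith [ht.1]⟩ a b hab

lemma Sm.ph_le {u v : X} (h : Sm mk D u v) {a b : X} (hab : mk a b) : ph a b u - ph a b v ≤ D := by
  obtain ⟨γ, hγ, h⟩ := h
  have := h 0 ⟨le_rfl, dist_nonneg⟩ _ ⟨dist_nonneg, le_rfl⟩ a b hab
  rwa [hγ.1, hγ.2.1] at this

lemma Sm.restrict {u v : X} {γ : ℝ → X} (hγ : Geo γ u v) {r : ℝ} (hr : r ∈ Set.Icc 0 (dist u v))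
    (h : ∀ s ∈ Set.Icc 0 r, ∀ t ∈ Set.Icc 0 r,
      ∀ a b, mk a b → ph a b (γ s) - ph a b (γ t) ≤ D) : Sm mk D u (γ r) := by
  have h1 := hγ.sub le_rfl hr.1 hr.2
  rw [hγ.1] at h1
  refine ⟨_, h1, ?_⟩
  rw [hγ.d0 hr]
  simpa using h

lemma Sm.of_le (hX : IsGeodesicSpace X) (hD : 1 ≤ D) {u v : X} (h : dist u v ≤ 1) :
    Sm mk D u v := by
  obtain ⟨γ, hγ⟩ := hX u v
  refine ⟨γ, hγ, fun s hs t ht a b _ => (ph_lip _ _ _ _).trans ?_⟩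
  rw [hγ.2.2 s hs t ht, abs_le]
  exact ⟨by linarith [hs.1, ht.2], by linarith [hs.2, ht.1]⟩

variable (mk D)

/-- The graph of small pairs. -/
def Gr : SimpleGraph X where
  Adj u v := u ≠ v ∧ Sm mk D u v
  symm := ⟨fun _ _ h => ⟨h.1.symm, h.2.symm⟩⟩
  loopless := ⟨fun _ h => h.1 rfl⟩

variable {mk D}

lemma exists_walk (hX : IsGeodesicSpace X) (hD : 1 ≤ D) (k : ℕ) : ∀ x y : X, dist x y ≤ k →
    ∃ w : (Gr mk D).Walk x y, w.length ≤ k := by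
  induction k with
  | zero =>
    intro x y h
    have : x = y := dist_le_zero.1 (by simpa using h)
    subst this
    exact ⟨.nil, le_rfl⟩
  | succ k ih =>
    intro x y h
    push_cast at h
    obtain ⟨γ, hγ⟩ := hX x y
    change Geo γ x y at hγ
    have hm : min 1 (dist x y) ∈ Set.Icc 0 (dist x y) :=
      ⟨le_min zero_le_one dist_nonneg, min_le_right _ _⟩
    have h0 := hγ.d0 hm
    have h1 := hγ.d1 hm
    obtain ⟨w, hw⟩ := ih (γ (min 1 (dist x y))) y (by
      rw [h1]
      rcases min_cases 1 (dist x y) with ⟨m, -⟩ | ⟨m, -⟩ <;> rw [m]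
      · linarith
      · simp)
    by_cases hx : x = γ (min 1 (dist x y))
    · exact ⟨w.copy hx.symm rfl, by simpa using hw.trans (Nat.le_succ k)⟩
    · have hadj : (Gr mk D).Adj x (γ (min 1 (dist x y))) :=
        ⟨hx, Sm.of_le hX hD (by rw [h0]; exact min_le_left _ _)⟩
      refine ⟨.cons hadj w, ?_⟩
      rw [SimpleGraph.Walk.length_cons]
      exact Nat.succ_le_succ hw

lemma conn (hX : IsGeodesicSpace X) (hD : 1 ≤ D) [Nonempty X] : (Gr mk D).Connected :=
  ⟨fun x y => by
    obtain ⟨k, hk⟩ := exists_nat_ge (dist x y)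
    obtain ⟨w, -⟩ := exists_walk (mk := mk) hX hD k x y hk
    exact ⟨w⟩⟩

/-- The coned-off pseudometric. -/
noncomputable def cPM (hc : (Gr mk D).Connected) : PM X where
  e x y := (Gr mk D).dist x y
  e0 x := by simp
  symm x y := by rw [SimpleGraph.dist_comm]
  tri x y z := by exact_mod_cast hc.dist_triangle

lemma cPM_le (hX : IsGeodesicSpace X) (hD : 1 ≤ D) (hc : (Gr mk D).Connected) (x y : X) :
    (cPM hc).e x y ≤ dist x y + 1 := by
  obtain ⟨w, hw⟩ := exists_walk (mk := mk) hX hD ⌈dist x y⌉₊ x y (Nat.le_ceil _)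
  have h1 : (Gr mk D).dist x y ≤ ⌈dist x y⌉₊ := (SimpleGraph.dist_le w).trans hw
  have h2 := (Nat.ceil_lt_add_one (dist_nonneg (x := x) (y := y))).le
  have h3 : (((Gr mk D).dist x y : ℕ) : ℝ) ≤ ⌈dist x y⌉₊ := by exact_mod_cast h1
  exact h3.trans h2

lemma Sm.e_le (hc : (Gr mk D).Connected) {x y : X} (h : Sm mk D x y) : (cPM hc).e x y ≤ 1 := by
  by_cases hxy : x = y
  · rw [hxy, (cPM hc).e0]
    exact zero_le_one
  · have : (Gr mk D).Adj x y := ⟨hxy, h⟩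
    show (((Gr mk D).dist x y : ℕ) : ℝ) ≤ 1
    rw [SimpleGraph.dist_eq_one_iff_adj.2 this]
    simp

lemma Sm.ed {δ : ℝ} (H : FP X δ) (hX : IsGeodesicSpace X) (hD : 1 ≤ D)
    (hc : (Gr mk D).Connected) {u v : X} (h : Sm mk D u v) : Ed (cPM hc).e (2 * δ + 2) u v := by
  intro p
  obtain ⟨γ, hγ, h⟩ := h
  obtain ⟨t, ht, hd⟩ := near H hγ p
  have h1 : Sm mk D u (γ t) := Sm.restrict hγ ht fun s hs s' hs' =>
    h s ⟨hs.1, hs.2.trans ht.2⟩ s' ⟨hs'.1, hs'.2.trans ht.2⟩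
  have h2 := h1.e_le hc
  have h3 := (cPM hc).tri p (γ t) u
  rw [(cPM hc).symm (γ t)] at h3
  have h4 := cPM_le hX hD hc p (γ t)
  linarith

lemma chain (hc : (Gr mk D).Connected) (x y : X) : ∃ (N : ℕ) (u : ℕ → X), u 0 = x ∧ u N = y ∧
    (cPM hc).e x y = N ∧ (∀ i < N, Sm mk D (u i) (u (i + 1))) ∧
    ∀ i j, i ≤ j → j ≤ N → (cPM hc).e (u i) (u j) = j - i := by
  obtain ⟨w, hw⟩ := hc.exists_walk_length_eq_dist x y
  have hs : ∀ i < w.length, Sm mk D (w.getVert i) (w.getVert (i + 1)) := fun i hi =>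
    (w.adj_getVert_succ hi).2
  have hN : (cPM hc).e x y = w.length := by rw [hw]; rfl
  have hle : ∀ i j, i ≤ j → j ≤ w.length → (cPM hc).e (w.getVert i) (w.getVert j) ≤ j - i := by
    intro i j hij
    induction j, hij using Nat.le_induction with
    | base => intro _; rw [(cPM hc).e0]; simp
    | succ j hij ih =>
      intro hj
      have h1 := ih (by omega)
      have h2 := (hs j (by omega)).e_le hc
      have h3 := (cPM hc).tri (w.getVert i) (w.getVert j) (w.getVert (j + 1))
      push_cast
      linarith
  refine ⟨w.length, w.getVert, by simp, by simp, hN, hs, fun i j hij hj => ?_⟩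
  refine le_antisymm (hle i j hij hj) ?_
  have h1 := hle 0 i (Nat.zero_le _) (hij.trans hj)
  have h2 := hle j w.length hj le_rfl
  rw [SimpleGraph.Walk.getVert_zero] at h1
  rw [SimpleGraph.Walk.getVert_length] at h2
  have h3 := (cPM hc).tri x (w.getVert i) y
  have h4 := (cPM hc).tri (w.getVert i) (w.getVert j) y
  push_cast at h1
  linarith

lemma chn_c {δ : ℝ} (H : FP X δ) (hX : IsGeodesicSpace X) (hD : 1 ≤ D)
    (hc : (Gr mk D).Connected) : Chn (cPM hc).e (2 * δ + 2) := by
  intro x y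
  obtain ⟨N, u, h0, hN, he, hs, hd⟩ := chain hc x y
  refine ⟨N, u, h0, hN, by linarith, fun i hi => (hs i hi).ed H hX hD hc, fun i hi => ?_⟩
  have := hd 0 i (Nat.zero_le _) hi
  rw [h0] at this
  rw [this, he]
  have : (i : ℝ) ≤ N := by exact_mod_cast hi
  push_cast
  linarith

lemma between {δ : ℝ} (hδ : 0 ≤ δ) (H : FP X δ) (hX : IsGeodesicSpace X) (hD : 1 ≤ D)
    (hc : (Gr mk D).Connected) : ∃ M : ℝ, ∀ x y m : X,
      (cPM hc).e x m + (cPM hc).e m y ≤ (cPM hc).e x y + 2 * gp m x y + M := by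
  obtain ⟨M, hM⟩ := stab hδ H hX (cPM hc) (C := 2 * δ + 2) (by linarith)
    (fun x y => (cPM_le hX hD hc x y).trans (by linarith)) (chn_c H hX hD hc) 1 0 zero_le_one le_rfl
  refine ⟨2 * M, fun x y m => ?_⟩
  obtain ⟨N, u, h0, hN, he, hs, hd⟩ := chain hc x y
  obtain ⟨i, hi, h⟩ := hM N u (fun i hi => (hs i hi).ed H hX hD hc)
    (fun i j hij hj => by rw [hd i j hij hj]; simp) m
  rw [h0, hN] at h
  have h1 := hd 0 i (Nat.zero_le _) hi
  have h2 := hd i N hi le_rfl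
  rw [h0] at h1
  rw [hN] at h2
  have h3 := (cPM hc).tri x (u i) m
  have h4 := (cPM hc).tri m (u i) y
  rw [(cPM hc).symm (u i) m] at h3
  push_cast at h1
  linarith

lemma hyp_c {δ : ℝ} (hδ : 0 ≤ δ) (H : FP X δ) (hX : IsGeodesicSpace X) (hD : 1 ≤ D)
    (hc : (Gr mk D).Connected) : ∃ δ' : ℝ, 0 ≤ δ' ∧ ∀ x y z w,
      (cPM hc).e x y + (cPM hc).e z w ≤
        max ((cPM hc).e x z + (cPM hc).e y w) ((cPM hc).e x w + (cPM hc).e y z) + 2 * δ' := by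
  obtain ⟨M, hM⟩ := between hδ H hX hD hc
  have key : ∀ x y z w : X, dist x y + dist z w ≤ dist x z + dist y w + 2 * δ →
      (cPM hc).e x y + (cPM hc).e z w ≤ (cPM hc).e x z + (cPM hc).e y w + (10 * δ + 2 * M) := by
    intro x y z w h
    obtain ⟨γ, hγ⟩ := hX x z
    change Geo γ x z at hγ
    obtain ⟨t, ht, hg⟩ := meet hδ H hγ y w h
    have g0 : gp (γ t) x z = 0 := by
      unfold gp
      rw [dist_comm _ x, hγ.d0 ht, hγ.d1 ht]
      ring
    have h1 := hM x z (γ t)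
    have h2 := hM y w (γ t)
    have h3 := (cPM hc).tri x (γ t) y
    have h4 := (cPM hc).tri z (γ t) w
    rw [(cPM hc).symm (γ t) y] at h3
    rw [(cPM hc).symm z (γ t)] at h4
    rw [g0] at h1
    linarith
  refine ⟨|10 * δ + 2 * M|, abs_nonneg _, fun x y z w => ?_⟩
  have hb := le_abs_self (10 * δ + 2 * M)
  have hb' := abs_nonneg (10 * δ + 2 * M)
  have h := H x y z w
  rcases max_cases (dist x z + dist y w) (dist x w + dist y z) with ⟨m, -⟩ | ⟨m, -⟩ <;> rw [m] at h
  · have := key x y z w h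
    linarith [le_max_left ((cPM hc).e x z + (cPM hc).e y w) ((cPM hc).e x w + (cPM hc).e y z)]
  · have := key x y w z (by rw [dist_comm w z]; exact h)
    rw [(cPM hc).symm w z] at this
    linarith [le_max_right ((cPM hc).e x z + (cPM hc).e y w) ((cPM hc).e x w + (cPM hc).e y z)]

lemma cgeo (hc : (Gr mk D).Connected) (x y : X) (t : ℝ) (h0 : 0 ≤ t) (h1 : t ≤ (cPM hc).e x y) :
    ∃ z, (cPM hc).e x z ≤ t + 1 ∧ (cPM hc).e z y ≤ (cPM hc).e x y - t + 1 := by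
  obtain ⟨N, u, hu0, hN, he, hs, hd⟩ := chain hc x y
  have hf : (⌊t⌋₊ : ℝ) ≤ t := Nat.floor_le h0
  have hf' := Nat.lt_floor_add_one t
  have hi : ⌊t⌋₊ ≤ N := by
    have : (⌊t⌋₊ : ℝ) ≤ N := by linarith
    exact_mod_cast this
  refine ⟨u ⌊t⌋₊, ?_, ?_⟩
  · have := hd 0 _ (Nat.zero_le _) hi
    rw [hu0] at this
    push_cast at this
    linarith
  · have := hd _ N hi le_rfl
    rw [hN] at this
    linarith

lemma ph_chain (hc : (Gr mk D).Connected) {a b : X} (hab : mk a b) (x y : X) :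
    ph a b x - ph a b y ≤ D * (cPM hc).e x y := by
  obtain ⟨w, hw⟩ := hc.exists_walk_length_eq_dist x y
  have : ∀ (x y : X) (w : (Gr mk D).Walk x y), ph a b x - ph a b y ≤ D * w.length := by
    intro x y w
    induction w with
    | nil => simp
    | cons h p ih =>
      have := h.2.ph_le hab
      rw [SimpleGraph.Walk.length_cons]
      push_cast
      linarith
  have h := this x y w
  rw [hw] at h
  exact h

lemma e_map (hc : (Gr mk D).Connected) (f f' : X → X) (hf : ∀ x y, dist (f x) (f y) = dist x y)
    (hf' : ∀ x, f (f' x) = x) (hmk : ∀ a b, mk a b → mk (f' a) (f' b)) (x y : X) :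
    (cPM hc).e (f x) (f y) ≤ (cPM hc).e x y := by
  have hph : ∀ a b p, ph a b (f p) = ph (f' a) (f' b) p := by
    intro a b p
    unfold ph
    rw [← hf p (f' a), ← hf p (f' b), hf', hf']
  have hS : ∀ u v, Sm mk D u v → Sm mk D (f u) (f v) := by
    rintro u v ⟨γ, hγ, h⟩
    refine ⟨fun t => f (γ t), ⟨?_, ?_, ?_⟩, ?_⟩
    · simp only [hγ.1]
    · simp only [hf, hγ.2.1]
    · simp only [hf]
      exact hγ.2.2
    · simp only [hf, hph]
      intro s hs t ht a b hab
      exact h s hs t ht _ _ (hmk a b hab)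
  let φ : (Gr mk D) →g (Gr mk D) := ⟨f, fun {u v} h => ⟨fun hh => h.1 (by
    have : dist (f u) (f v) = 0 := by rw [hh, dist_self]
    rw [hf] at this
    exact dist_eq_zero.1 this), hS u v h.2⟩⟩
  obtain ⟨w, hw⟩ := hc.exists_walk_length_eq_dist x y
  have h1 : (Gr mk D).dist (f x) (f y) ≤ (w.map φ).length := SimpleGraph.dist_le (w.map φ)
  rw [SimpleGraph.Walk.length_map, hw] at h1
  show (((Gr mk D).dist (f x) (f y) : ℕ) : ℝ) ≤ (((Gr mk D).dist x y : ℕ) : ℝ)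
  exact_mod_cast h1

lemma cob {δ : ℝ} (hδ : 0 ≤ δ) (H : FP X δ) (hX : IsGeodesicSpace X) (hD : 1 ≤ D) (hDδ : δ ≤ D)
    (hc : (Gr mk D).Connected) (x x₀ : X) : ∃ m, (cPM hc).e x m ≤ 3 ∧
      (m = x₀ ∨ ∃ a b, mk a b ∧ gp m a b ≤ 5 * δ) := by
  obtain ⟨γ, hγ⟩ := hX x x₀
  change Geo γ x x₀ at hγ
  set l := dist x x₀ with hl
  have hl0 : 0 ≤ l := dist_nonneg
  by_cases hbad : ∃ k : ℕ, ∃ s ∈ Set.Icc 0 (min (k : ℝ) l), ∃ t ∈ Set.Icc 0 (min (k : ℝ) l),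
      ∃ a b, mk a b ∧ D < ph a b (γ s) - ph a b (γ t)
  · classical
    set k := Nat.find hbad with hk
    obtain ⟨s, hs, t, ht, a, b, hab, hbig⟩ := Nat.find_spec hbad
    rw [← hk] at hs ht
    have hk0 : k ≠ 0 := by
      intro h
      rw [h] at hs ht
      have e1 : min ((0 : ℕ) : ℝ) l = 0 := by simp [hl0]
      rw [e1] at hs ht
      rw [le_antisymm hs.2 hs.1, le_antisymm ht.2 ht.1] at hbig
      linarith
    have hmin := Nat.find_min hbad (m := k - 1) (by omega)
    push Not at hmin
    have hk1 : ((k - 1 : ℕ) : ℝ) = k - 1 := by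
      rw [Nat.cast_sub (by omega)]
      simp
    have hk2 : (0 : ℝ) ≤ (k : ℝ) - 1 := by
      rw [← hk1]
      exact Nat.cast_nonneg _
    rw [hk1] at hmin
    have reach : ∀ ρ, 0 ≤ ρ → ρ ≤ min (k : ℝ) l → (cPM hc).e x (γ ρ) ≤ 3 := by
      intro ρ h0 h1
      have hρl : ρ ≤ l := h1.trans (min_le_right _ _)
      have hρk : ρ ≤ k := h1.trans (min_le_left _ _)
      have hr : min ρ (k - 1) ∈ Set.Icc 0 l := ⟨le_min h0 hk2, (min_le_left _ _).trans hρl⟩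
      have hr' : min ρ (k - 1) ≤ min ((k : ℝ) - 1) l :=
        le_min (min_le_right _ _) ((min_le_left _ _).trans hρl)
      have h2 : Sm mk D x (γ (min ρ (k - 1))) := Sm.restrict hγ hr fun s hs t ht a b hab =>
        hmin s ⟨hs.1, hs.2.trans hr'⟩ t ⟨ht.1, ht.2.trans hr'⟩ a b hab
      have h3 := h2.e_le hc
      have h4 := cPM_le hX hD hc (γ (min ρ (k - 1))) (γ ρ)
      rw [hγ.2.2 _ hr _ ⟨h0, hρl⟩] at h4
      have h5 : |min ρ ((k : ℝ) - 1) - ρ| ≤ 1 := by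
        rw [abs_le]
        constructor
        · have : ρ - 1 ≤ min ρ ((k : ℝ) - 1) := le_min (by linarith) (by linarith)
          linarith
        · linarith [min_le_left ρ ((k : ℝ) - 1)]
      have h6 := (cPM hc).tri x (γ (min ρ (k - 1))) (γ ρ)
      linarith
    have h4 : dist (γ s) a + dist (γ t) b ≤ dist (γ s) (γ t) + dist a b + 2 * δ := by
      have h := H (γ s) a (γ t) b
      unfold ph at hbig
      rw [dist_comm a (γ t)] at h
      rcases max_cases (dist (γ s) (γ t) + dist a b) (dist (γ s) b + dist (γ t) a) with
        ⟨m, -⟩ | ⟨m, -⟩ <;> rw [m] at h <;> linarith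
    rcases le_total s t with hst | hst
    · have hg := hγ.sub hs.1 hst (ht.2.trans (min_le_right _ _))
      obtain ⟨r, hr, hgp⟩ := meet hδ H hg a b h4
      have hd : dist (γ s) (γ t) = t - s := by
        rw [hγ.2.2 s ⟨hs.1, hs.2.trans (min_le_right _ _)⟩ t ⟨ht.1, ht.2.trans (min_le_right _ _)⟩,
          abs_of_nonpos (by linarith)]
        ring
      rw [hd] at hr
      exact ⟨γ (s + r), reach _ (by linarith [hs.1, hr.1]) (by linarith [hr.2, ht.2]),
        .inr ⟨a, b, hab, hgp⟩⟩
    · have hg := hγ.sub ht.1 hst (hs.2.trans (min_le_right _ _))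
      obtain ⟨r, hr, hgp⟩ := meet hδ H hg b a (by
        rw [dist_comm (γ t) (γ s), dist_comm b a]; linarith)
      have hd : dist (γ t) (γ s) = s - t := by
        rw [hγ.2.2 t ⟨ht.1, ht.2.trans (min_le_right _ _)⟩ s ⟨hs.1, hs.2.trans (min_le_right _ _)⟩,
          abs_of_nonpos (by linarith)]
        ring
      rw [hd] at hr
      rw [gp_comm] at hgp
      exact ⟨γ (t + r), reach _ (by linarith [ht.1, hr.1]) (by linarith [hr.2, hs.2]),
        .inr ⟨a, b, hab, hgp⟩⟩
  · push Not at hbad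
    obtain ⟨k, hk⟩ := exists_nat_ge l
    have h := hbad k
    rw [min_eq_right hk] at h
    have h2 : Sm mk D x x₀ := ⟨γ, hγ, h⟩
    exact ⟨x₀, (h2.e_le hc).trans (by norm_num), .inl rfl⟩

end Hyp

/-- If `G` admits an isometric action on a Gromov hyperbolic geodesic metric
space with a loxodromic element, then it admits a cobounded such action. -/
theorem exists_cobounded_action_with_loxodromic {G : Type*} [Group G]
    (h : ∃ (X : Type) (m : MetricSpace X) (a : G → X → X),
      @IsGeodesicSpace X m ∧ @IsGromovHyperbolic X m ∧
        @IsIsometricAction G _ X m a ∧ ∃ g : G, @IsLoxodromic G _ X m a g) :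
    ∃ (Y : Type) (m : MetricSpace Y) (a : G → Y → Y),
      @IsGeodesicSpace Y m ∧ @IsGromovHyperbolic Y m ∧
        @IsIsometricAction G _ Y m a ∧ @IsCoboundedAction G _ Y m a ∧
        ∃ g : G, @IsLoxodromic G _ Y m a g := by

  obtain ⟨X, _, a, hX, ⟨δ, hδ, H⟩, ⟨h1, hm, hi⟩, g, x₀, A, B, hA, hB, hlox⟩ := h
  change Hyp.FP X δ at H
  have hne : Nonempty X := ⟨x₀⟩
  have hA0 : 0 < A := by linarith
  have hinv : ∀ (g : G) x, a g⁻¹ (a g x) = x := fun g x => by rw [← hm, inv_mul_cancel, h1]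
  have hinv' : ∀ (g : G) x, a g (a g⁻¹ x) = x := fun g x => by rw [← hm, mul_inv_cancel, h1]
  -- the Morse property of the orbit
  obtain ⟨R, hR⟩ := Hyp.stab hδ H hX (Hyp.dPM X) (C := A + B) (by linarith)
    (fun x y => show dist x y ≤ dist x y + (A + B) by linarith)
    (Hyp.chn_dist hX (by linarith)) A (A * B) hA0.le (by positivity)
  have morse : ∀ (n : ℕ) (p : X), ∃ i : ℕ,
      dist p (a (g ^ i) x₀) ≤ Hyp.gp p x₀ (a (g ^ n) x₀) + R := by
    intro n p
    obtain ⟨i, -, h⟩ := hR n (fun i => a (g ^ i) x₀) (fun i _ => Hyp.Ed_of_le (by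
      have := (hlox (i : ℤ) ((i + 1 : ℕ) : ℤ)).2
      simp only [zpow_natCast] at this
      push_cast at this
      simpa using this)) (fun i j hij _ => by
      have h := (hlox (i : ℤ) (j : ℤ)).1
      simp only [zpow_natCast] at h
      push_cast at h
      have hij' : (i : ℝ) ≤ j := by exact_mod_cast hij
      rw [abs_of_nonpos (by linarith), sub_le_iff_le_add, div_le_iff₀ hA0] at h
      show (j : ℝ) - i ≤ A * dist (a (g ^ i) x₀) (a (g ^ j) x₀) + A * B
      linarith) p
    refine ⟨i, ?_⟩
    simp only [pow_zero, h1] at h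
    exact h
  let mk : X → X → Prop := fun p q => ∃ (h : G) (n : ℕ), p = a h x₀ ∧ q = a h (a (g ^ n) x₀)
  have hmk : ∀ (h : G) p q, mk p q → mk (a h p) (a h q) := by
    rintro h p q ⟨k, n, rfl, rfl⟩
    exact ⟨h * k, n, (hm _ _ _).symm, (hm _ _ _).symm⟩
  have hD : (1 : ℝ) ≤ δ + 1 := by linarith
  have hc : (Hyp.Gr mk (δ + 1)).Connected := Hyp.conn hX hD
  obtain ⟨δ', hδ', H'⟩ := Hyp.hyp_c hδ H hX hD hc
  have hle : ∀ h x y, (Hyp.cPM hc).e (a h x) (a h y) ≤ (Hyp.cPM hc).e x y := fun h x y =>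
    Hyp.e_map hc (a h) (a h⁻¹) (hi h) (hinv' h) (hmk h⁻¹) x y
  have hiso : ∀ h x y, (Hyp.cPM hc).e (a h x) (a h y) = (Hyp.cPM hc).e x y := fun h x y => by
    refine le_antisymm (hle h x y) ?_
    have := hle h⁻¹ (a h x) (a h y)
    rwa [hinv, hinv] at this
  have low : ∀ m n : ℤ, m ≤ n → dist (a (g ^ m) x₀) (a (g ^ n) x₀) ≤
      (δ + 1) * (Hyp.cPM hc).e (a (g ^ m) x₀) (a (g ^ n) x₀) := by
    intro m n hmn
    obtain ⟨k, rfl⟩ := Int.le.dest hmn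
    have hk : mk (a (g ^ m) x₀) (a (g ^ (m + (k : ℤ))) x₀) :=
      ⟨g ^ m, k, rfl, by rw [zpow_add, hm, zpow_natCast]⟩
    have h := Hyp.ph_chain hc hk (a (g ^ (m + (k : ℤ))) x₀) (a (g ^ m) x₀)
    rw [(Hyp.cPM hc).symm] at h
    unfold Hyp.ph at h
    rw [dist_self, dist_self, dist_comm (a (g ^ (m + (k : ℤ))) x₀)] at h
    linarith
  have low' : ∀ m n : ℤ, dist (a (g ^ m) x₀) (a (g ^ n) x₀) ≤
      (δ + 1) * (Hyp.cPM hc).e (a (g ^ m) x₀) (a (g ^ n) x₀) := by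
    intro m n
    rcases le_total m n with h | h
    · exact low m n h
    · rw [dist_comm, (Hyp.cPM hc).symm]
      exact low n m h
  refine PM.main (Hyp.cPM hc) a hiso h1 hm hδ' H' (Hyp.cgeo hc) x₀ (C := |5 * δ + R| + 4) ?_ g
    (A := A * (δ + 1)) (B := B + 1) (by nlinarith) (by linarith) ?_
  · intro x
    obtain ⟨m, hm3, hmm⟩ := Hyp.cob hδ H hX hD (by linarith) hc x x₀
    rcases hmm with rfl | ⟨p, q, ⟨h, n, rfl, rfl⟩, hgp⟩
    · refine ⟨1, ?_⟩
      rw [h1]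
      linarith [abs_nonneg (5 * δ + R)]
    · obtain ⟨i, hi'⟩ := morse n (a h⁻¹ m)
      refine ⟨h * g ^ i, ?_⟩
      have e1 : Hyp.gp (a h⁻¹ m) x₀ (a (g ^ n) x₀) = Hyp.gp m (a h x₀) (a h (a (g ^ n) x₀)) := by
        unfold Hyp.gp
        rw [← hi h (a h⁻¹ m), ← hi h (a h⁻¹ m), ← hi h x₀, hinv']
      rw [e1, ← hi h, hinv', ← hm] at hi'
      have h2 := Hyp.cPM_le hX hD hc m (a (h * g ^ i) x₀)
      have h3 := (Hyp.cPM hc).tri x m (a (h * g ^ i) x₀)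
      linarith [le_abs_self (5 * δ + R)]
  · intro m n
    have hl := hlox m n
    have hn := (Hyp.cPM hc).e_nonneg (a (g ^ m) x₀) (a (g ^ n) x₀)
    constructor
    · have h3 := hl.1.trans (low' m n)
      rw [← div_div, sub_le_iff_le_add, div_le_iff₀ (by linarith)]
      nlinarith
    · have h3 := Hyp.cPM_le hX hD hc (a (g ^ m) x₀) (a (g ^ n) x₀)
      have : 0 ≤ A * |(m : ℝ) - n| * δ := by positivity
      nlinarith
end
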